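/- There exist absolute constants c > 0 and c* > 0 with the following property. Let A ⊂ ℤ be a finite set and s ≥ 5 an integer with s ≤ c·log|A| / √(log log|A| · log log log|A|). Then there exist disjoint sets B and C with A = B ⊔ C such that max{ T_s^+(B), T_s^×(C) } ≤ |A|^{2s − c*·√(log s / log log s)}. -/

import Mathlib

open Finset Pointwise

universe u

/-- A finset `Λ` in an abelian group is `k`-dissociated if every integer relation
`∑ ε_λ • λ = 0` with `|ε_λ| ≤ k` forces all `ε_λ = 0`. -/
def IsKDissociated {G : Type*} [AddCommGroup G] (k : ℕ) (Λ : Finset G) : Prop :=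
  ∀ ε : G → ℤ, (∀ x ∈ Λ, |ε x| ≤ (k : ℤ)) → (∑ x ∈ Λ, ε x • x) = 0 → ∀ x ∈ Λ, ε x = 0

/-- `addDim k A` is the maximal size of a `k`-dissociated subset of `A`. -/
noncomputable def addDim {G : Type*} [AddCommGroup G] (k : ℕ) (A : Finset G) : ℕ :=
  sSup {n : ℕ | ∃ Λ : Finset G, Λ ⊆ A ∧ Λ.card = n ∧ IsKDissociated k Λ}

/-- `nFold A n` is the `n`-fold sumset `A + A + ⋯ + A` (`n` summands). -/
def nFold {G : Type*} [AddCommGroup G] [DecidableEq G] (A : Finset G) : ℕ → Finset G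
  | 0 => {0}
  | n + 1 => nFold A n + A

/-- `TkAdd s A` counts tuples `(a₁,…,a_{2s}) ∈ A^{2s}` with
`a₁ + ⋯ + a_s = a_{s+1} + ⋯ + a_{2s}` (the energy `T_s^+(A)`). -/
noncomputable def TkAdd (s : ℕ) (A : Finset ℤ) : ℕ :=
  Set.ncard {f : (Fin s → ℤ) × (Fin s → ℤ) |
    (∀ i, f.1 i ∈ A) ∧ (∀ i, f.2 i ∈ A) ∧ ∑ i, f.1 i = ∑ i, f.2 i}

/-- `TkMul s A` counts tuples `(a₁,…,a_{2s}) ∈ A^{2s}` with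
`a₁ ⋯ a_s = a_{s+1} ⋯ a_{2s}` (the energy `T_s^×(A)`). -/
noncomputable def TkMul (s : ℕ) (A : Finset ℤ) : ℕ :=
  Set.ncard {f : (Fin s → ℤ) × (Fin s → ℤ) |
    (∀ i, f.1 i ∈ A) ∧ (∀ i, f.2 i ∈ A) ∧ ∏ i, f.1 i = ∏ i, f.2 i}

/-- `Bd s f b`: the normalised `L^{2s}` norm of `f` is at most `b`. -/
def Bd {X : Type*} [Fintype X] (s : ℕ) (f : X → ℂ) (b : ℝ) : Prop :=
  ∑ x, ‖f x‖ ^ (2 * s) ≤ (Fintype.card X : ℝ) * b ^ (2 * s)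

theorem pow_amgm (α β : ℕ) (h : 0 < α + β) (u v : ℝ) (hu : 0 ≤ u) (hv : 0 ≤ v) :
    u ^ α * v ^ β ≤ ((α : ℝ) / (α + β : ℕ)) * u ^ (α + β) + ((β : ℝ) / (α + β : ℕ)) * v ^ (α + β) := by
  have hn : (0 : ℝ) < ((α + β : ℕ) : ℝ) := by exact_mod_cast h
  have := Real.geom_mean_le_arith_mean2_weighted (w₁ := (α : ℝ) / (α + β : ℕ)) (w₂ := (β : ℝ) / (α + β : ℕ))
    (p₁ := u ^ (α + β)) (p₂ := v ^ (α + β)) (by positivity) (by positivity) (by positivity) (by positivity)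
    (by rw [← add_div]; push_cast at *; exact div_self hn.ne')
  have e1 : ∀ (w : ℝ) (k : ℕ), 0 ≤ w → (w ^ (α + β)) ^ ((k : ℝ) / (α + β : ℕ)) = w ^ k := by
    intro w k hw
    rw [← Real.rpow_natCast w (α + β), ← Real.rpow_mul hw, mul_div_cancel₀ _ hn.ne', Real.rpow_natCast]
  rw [e1 _ _ hu, e1 _ _ hv] at this
  exact this

theorem Bd.holder {X : Type*} [Fintype X] {s : ℕ} (hs : 0 < s) {f g : X → ℂ} {b c : ℝ} (hb : 0 < b) (hc : 0 < c)
    (hf : Bd s f b) (hg : Bd s g c) (α β : ℕ) (h : α + β = 2 * s) :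
    ∑ x, ‖f x‖ ^ α * ‖g x‖ ^ β ≤ (Fintype.card X : ℝ) * (b ^ α * c ^ β) := by
  have hn : 0 < α + β := by omega
  have hn' : (0 : ℝ) < ((α + β : ℕ) : ℝ) := by exact_mod_cast hn
  have key : ∀ x, ‖f x‖ ^ α * ‖g x‖ ^ β ≤ b ^ α * c ^ β *
      (((α : ℝ) / (α + β : ℕ)) * (‖f x‖ ^ (α + β) / b ^ (α + β)) +
        ((β : ℝ) / (α + β : ℕ)) * (‖g x‖ ^ (α + β) / c ^ (α + β))) := by
    intro x
    have := pow_amgm α β hn (‖f x‖ / b) (‖g x‖ / c) (by positivity) (by positivity)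
    simp only [div_pow] at this
    calc _ = b ^ α * c ^ β * (‖f x‖ ^ α / b ^ α * (‖g x‖ ^ β / c ^ β)) := by field_simp
      _ ≤ _ := by gcongr
  refine (Finset.sum_le_sum fun x _ => key x).trans ?_
  rw [← Finset.mul_sum, Finset.sum_add_distrib, ← Finset.mul_sum, ← Finset.mul_sum,
    ← Finset.sum_div, ← Finset.sum_div]
  unfold Bd at hf hg
  rw [← h] at hf hg
  have h1 : (∑ x, ‖f x‖ ^ (α + β)) / b ^ (α + β) ≤ Fintype.card X := by
    rw [div_le_iff₀ (by positivity)]; exact hf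
  have h2 : (∑ x, ‖g x‖ ^ (α + β)) / c ^ (α + β) ≤ Fintype.card X := by
    rw [div_le_iff₀ (by positivity)]; exact hg
  have h3 : ((α : ℝ) / (α + β : ℕ)) + ((β : ℝ) / (α + β : ℕ)) = 1 := by
    rw [← add_div]; push_cast at *; exact div_self hn'.ne'
  calc _ ≤ b ^ α * c ^ β * (((α : ℝ) / (α + β : ℕ)) * Fintype.card X + ((β : ℝ) / (α + β : ℕ)) * Fintype.card X) := by
        gcongr
    _ = _ := by rw [← add_mul, h3]; ring

theorem norm_sum_pow_le {J : Type*} (S : Finset J) (z : J → ℂ) (θ : J → ℝ) (hθ : ∀ j ∈ S, 0 < θ j)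
    (h1 : ∑ j ∈ S, θ j = 1) (k : ℕ) :
    ‖∑ j ∈ S, z j‖ ^ k ≤ ∑ j ∈ S, θ j * (‖z j‖ / θ j) ^ k := by
  have : ‖∑ j ∈ S, z j‖ ≤ ∑ j ∈ S, θ j * (‖z j‖ / θ j) := by
    refine (norm_sum_le _ _).trans (Finset.sum_le_sum fun j hj => ?_)
    have := hθ j hj
    rw [mul_div_cancel₀ _ this.ne']
  refine (pow_le_pow_left₀ (norm_nonneg _) this k).trans ?_
  exact Real.pow_arith_mean_le_arith_mean_pow S θ _ (fun j hj => (hθ j hj).le) h1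
    (fun j hj => div_nonneg (norm_nonneg _) (hθ j hj).le) k

theorem Bd.sum {X : Type*} [Fintype X] {s : ℕ} {J : Type*} (S : Finset J) (hS : S.Nonempty)
    {f : J → X → ℂ} {b : J → ℝ} (hb : ∀ j ∈ S, 0 < b j)
    (hf : ∀ j ∈ S, Bd s (f j) (b j)) : Bd s (fun x => ∑ j ∈ S, f j x) (∑ j ∈ S, b j) := by
  set B := ∑ j ∈ S, b j with hB
  have hB0 : 0 < B := Finset.sum_pos hb hS
  unfold Bd
  have key : ∀ x, ‖∑ j ∈ S, f j x‖ ^ (2 * s) ≤ ∑ j ∈ S, (b j / B) * (‖f j x‖ / (b j / B)) ^ (2 * s) := by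
    intro x
    refine norm_sum_pow_le S _ _ (fun j hj => div_pos (hb j hj) hB0) ?_ _
    rw [← Finset.sum_div, div_self hB0.ne']
  refine (Finset.sum_le_sum fun x _ => key x).trans ?_
  rw [Finset.sum_comm]
  have : ∀ j ∈ S, ∑ x, (b j / B) * (‖f j x‖ / (b j / B)) ^ (2 * s) ≤ (b j / B) * ((Fintype.card X : ℝ) * B ^ (2 * s)) := by
    intro j hj
    have hbj := hb j hj
    rw [← Finset.mul_sum]
    refine mul_le_mul_of_nonneg_left ?_ (by positivity)
    simp only [div_pow]
    rw [← Finset.sum_div, div_le_iff₀ (by positivity)]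
    refine (hf j hj).trans (le_of_eq ?_)
    field_simp
  refine (Finset.sum_le_sum this).trans (le_of_eq ?_)
  rw [← Finset.sum_mul, ← Finset.sum_div, div_self hB0.ne', one_mul]

theorem Bd.mono {X : Type*} [Fintype X] {s : ℕ} {f : X → ℂ} {b c : ℝ} (hb : 0 ≤ b) (h : b ≤ c) (hf : Bd s f b) :
    Bd s f c := by
  unfold Bd at *
  refine hf.trans ?_
  gcongr

theorem Bd.of_le {X : Type*} [Fintype X] {s : ℕ} {f : X → ℂ} {b : ℝ} (h : ∀ x, ‖f x‖ ≤ b) :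
    Bd s f b := by
  unfold Bd
  calc _ ≤ ∑ x : X, b ^ (2 * s) := Finset.sum_le_sum fun x _ => pow_le_pow_left₀ (norm_nonneg _) (h x) _
    _ = _ := by simp

/-- Two-point energy. -/
noncomputable def DD (s : ℕ) (σ r : ℝ) : ℝ :=
  ∑ m ∈ range (s + 1), ((s.choose m : ℝ) * σ ^ (s - m) * r ^ m) ^ 2

theorem DD_mono (s : ℕ) {σ r σ' r' : ℝ} (h0 : 0 ≤ σ) (h1 : 0 ≤ r) (h : σ ≤ σ') (h' : r ≤ r') :
    DD s σ r ≤ DD s σ' r' := by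
  unfold DD
  have h2 : 0 ≤ σ' := h0.trans h
  gcongr

theorem char_sum {N : ℕ} [NeZero N] (a : ZMod N) :
    ∑ t : ZMod N, ZMod.stdAddChar (t * a) = if a = 0 then (N : ℂ) else 0 := by
  have := AddChar.sum_mulShift (R' := ℂ) a (ZMod.isPrimitive_stdAddChar N)
  rw [this]; simp

theorem parseval {N : ℕ} [NeZero N] (J : Finset ℕ) (hJ : ∀ j ∈ J, j < N) (c : ℕ → ℂ) :
    ∑ t : ZMod N, ‖∑ j ∈ J, ZMod.stdAddChar (t * (j : ZMod N)) * c j‖ ^ 2 = N * ∑ j ∈ J, ‖c j‖ ^ 2 := by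
  have : ∀ z : ℂ, ((‖z‖ ^ 2 : ℝ) : ℂ) = z * (starRingEnd ℂ) z := by
    intro z; rw [Complex.mul_conj, Complex.normSq_eq_norm_sq]
  have key : ((∑ t : ZMod N, ‖∑ j ∈ J, ZMod.stdAddChar (t * (j : ZMod N)) * c j‖ ^ 2 : ℝ) : ℂ)
      = ((N * ∑ j ∈ J, ‖c j‖ ^ 2 : ℝ) : ℂ) := by
    push_cast
    simp only [← Complex.ofReal_pow, this]
    simp only [map_sum, map_mul, Finset.sum_mul_sum, ← AddChar.map_neg_eq_conj]
    rw [Finset.sum_comm, Finset.mul_sum]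
    refine Finset.sum_congr rfl fun i hi => ?_
    rw [Finset.sum_comm]
    rw [Finset.sum_eq_single_of_mem i hi]
    · have : ∀ t : ZMod N, ZMod.stdAddChar (t * (i : ZMod N)) * c i * (ZMod.stdAddChar (-(t * (i : ZMod N))) * (starRingEnd ℂ) (c i))
        = c i * (starRingEnd ℂ) (c i) := by
        intro t
        have : (ZMod.stdAddChar (t * (i : ZMod N)) : ℂ) * ZMod.stdAddChar (-(t * (i : ZMod N))) = 1 := by
          rw [← AddChar.map_add_eq_mul]; simp
        linear_combination c i * (starRingEnd ℂ) (c i) * this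
      simp [this]
    · intro j hj hij
      have : ∀ t : ZMod N, ZMod.stdAddChar (t * (i : ZMod N)) * c i * (ZMod.stdAddChar (-(t * (j : ZMod N))) * (starRingEnd ℂ) (c j))
        = ZMod.stdAddChar (t * ((i : ZMod N) - (j : ZMod N))) * (c i * (starRingEnd ℂ) (c j)) := by
        intro t
        rw [mul_sub, sub_eq_add_neg, AddChar.map_add_eq_mul]; ring
      simp only [this, ← Finset.sum_mul]
      rw [char_sum, if_neg, zero_mul]
      intro h
      rw [sub_eq_zero, ZMod.natCast_eq_natCast_iff', Nat.mod_eq_of_lt (hJ i hi), Nat.mod_eq_of_lt (hJ j hj)] at h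
      exact hij h.symm
  exact_mod_cast key

theorem two_term {N s : ℕ} [Fact N.Prime] (hN : s < N) (k : ZMod N) (hk : k ≠ 0) (u w : ℂ) :
    ∑ t : ZMod N, ‖u + ZMod.stdAddChar (t * k) * w‖ ^ (2 * s) = N * DD s ‖u‖ ‖w‖ := by
  have e : ∑ t : ZMod N, ‖u + ZMod.stdAddChar (t * k) * w‖ ^ (2 * s)
      = ∑ t : ZMod N, ‖u + ZMod.stdAddChar t * w‖ ^ (2 * s) := by
    refine Fintype.sum_equiv (Equiv.mulRight₀ k hk) _ _ fun t => ?_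
    simp
  rw [e]
  have h2 : ∀ t : ZMod N, ‖u + ZMod.stdAddChar t * w‖ ^ (2 * s) =
      ‖∑ j ∈ range (s + 1), ZMod.stdAddChar (t * (j : ZMod N)) * ((s.choose j : ℂ) * u ^ (s - j) * w ^ j)‖ ^ 2 := by
    intro t
    rw [mul_comm 2 s, pow_mul, ← norm_pow, add_comm, add_pow]
    congr 2
    refine Finset.sum_congr rfl fun j _ => ?_
    rw [mul_comm t, ← nsmul_eq_mul, AddChar.map_nsmul_eq_pow, mul_pow]
    ring
  simp only [h2]
  rw [parseval (range (s + 1)) (fun j hj => by rw [mem_range] at hj; omega)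
    (fun j => (s.choose j : ℂ) * u ^ (s - j) * w ^ j)]
  unfold DD
  congr 1
  refine Finset.sum_congr rfl fun j _ => ?_
  simp

theorem char_norm {N : ℕ} [NeZero N] (a : ZMod N) : ‖(ZMod.stdAddChar a : ℂ)‖ = 1 := AddChar.norm_apply _ _

theorem caseA {X : Type*} [Fintype X] {N s : ℕ} [NeZero N] (hs : 0 < s) (J : Finset ℕ) (hne : J.Nonempty)
    (hJ : ∀ j ∈ J, j < N)
    (f : ℕ → X → ℂ) (b : ℕ → ℝ) (hb : ∀ j ∈ J, 0 < b j) (hf : ∀ j ∈ J, Bd s (f j) (b j)) :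
    ∑ x, ∑ t : ZMod N, ‖∑ j ∈ J, ZMod.stdAddChar (t * (j : ZMod N)) * f j x‖ ^ (2 * s) ≤
      N * ((Fintype.card X : ℝ) * ((∑ j ∈ J, b j) ^ (2 * s - 2) * ∑ j ∈ J, b j ^ 2)) := by
  have h1 : ∀ x, ∑ t : ZMod N, ‖∑ j ∈ J, ZMod.stdAddChar (t * (j : ZMod N)) * f j x‖ ^ (2 * s) ≤
      (∑ j ∈ J, ‖f j x‖) ^ (2 * s - 2) * (N * ∑ j ∈ J, ‖f j x‖ ^ 2) := by
    intro x
    rw [← parseval J hJ (fun j => f j x), Finset.mul_sum]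
    refine Finset.sum_le_sum fun t _ => ?_
    have : 2 * s = (2 * s - 2) + 2 := by omega
    conv_lhs => rw [this, pow_add]
    gcongr
    refine (norm_sum_le _ _).trans (le_of_eq ?_)
    refine Finset.sum_congr rfl fun j _ => ?_
    rw [norm_mul, char_norm, one_mul]
  refine (Finset.sum_le_sum fun x _ => h1 x).trans ?_
  have hB : Bd s (fun x => ∑ j ∈ J, ((‖f j x‖ : ℝ) : ℂ)) (∑ j ∈ J, b j) := by
    refine Bd.sum J hne hb fun j hj => ?_
    have := hf j hj
    unfold Bd at *
    simpa using this
  have hBn : ∀ x, ‖∑ j ∈ J, ((‖f j x‖ : ℝ) : ℂ)‖ = ∑ j ∈ J, ‖f j x‖ := by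
    intro x
    rw [← Complex.ofReal_sum, Complex.norm_real, Real.norm_of_nonneg]
    exact Finset.sum_nonneg fun _ _ => norm_nonneg _
  have h2 : ∀ j ∈ J, ∑ x, (∑ j ∈ J, ‖f j x‖) ^ (2 * s - 2) * ‖f j x‖ ^ 2 ≤
      (Fintype.card X : ℝ) * ((∑ j ∈ J, b j) ^ (2 * s - 2) * b j ^ 2) := by
    intro j hj
    have := Bd.holder hs (Finset.sum_pos hb hne) (hb j hj) hB (hf j hj) (2 * s - 2) 2 (by omega)
    simpa only [hBn] using this
  calc _ = N * ∑ j ∈ J, ∑ x, (∑ j ∈ J, ‖f j x‖) ^ (2 * s - 2) * ‖f j x‖ ^ 2 := by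
        rw [Finset.sum_comm, Finset.mul_sum]
        refine Finset.sum_congr rfl fun x _ => ?_
        rw [← Finset.mul_sum]; ring
    _ ≤ N * ∑ j ∈ J, (Fintype.card X : ℝ) * ((∑ j ∈ J, b j) ^ (2 * s - 2) * b j ^ 2) := by
        gcongr with j hj
        exact h2 j hj
    _ = _ := by rw [← Finset.mul_sum, ← Finset.mul_sum]

theorem caseB {X : Type*} [Fintype X] {N s : ℕ} [Fact N.Prime] (hs : 0 < s) (hN : s < N) (J : Finset ℕ)
    (hJ : ∀ j ∈ J, j < N) (j0 : ℕ) (hj0 : j0 ∈ J) (hne : (J.erase j0).Nonempty)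
    (f : ℕ → X → ℂ) (b : ℕ → ℝ) (hb : ∀ j ∈ J, 0 < b j) (hf : ∀ j ∈ J, Bd s (f j) (b j)) :
    ∑ x, ∑ t : ZMod N, ‖∑ j ∈ J, ZMod.stdAddChar (t * (j : ZMod N)) * f j x‖ ^ (2 * s) ≤
      N * ((Fintype.card X : ℝ) * DD s (b j0) (∑ j ∈ J.erase j0, b j)) := by
  set R := ∑ j ∈ J.erase j0, b j with hR
  have hR0 : 0 < R := Finset.sum_pos (fun j hj => hb j (Finset.mem_of_mem_erase hj)) hne
  have hpt : ∀ x, ∀ t : ZMod N, ‖∑ j ∈ J, ZMod.stdAddChar (t * (j : ZMod N)) * f j x‖ ^ (2 * s) ≤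
      ∑ j ∈ J.erase j0, (b j / R) *
        ‖f j0 x + ZMod.stdAddChar (t * ((j : ZMod N) - (j0 : ZMod N))) * (f j x * (R / b j : ℝ))‖ ^ (2 * s) := by
    intro x t
    have h1 : ∑ j ∈ J.erase j0, b j / R = 1 := by rw [← Finset.sum_div, div_self hR0.ne']
    have e : ∑ j ∈ J, ZMod.stdAddChar (t * (j : ZMod N)) * f j x =
        ∑ j ∈ J.erase j0, ((b j / R : ℝ) * (ZMod.stdAddChar (t * (j0 : ZMod N)) * f j0 x) +
          ZMod.stdAddChar (t * (j : ZMod N)) * f j x) := by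
      rw [← Finset.add_sum_erase J _ hj0, Finset.sum_add_distrib, ← Finset.sum_mul, ← Complex.ofReal_sum, h1]
      simp
    rw [e]
    refine (norm_sum_pow_le _ _ (fun j => b j / R)
      (fun j hj => div_pos (hb j (Finset.mem_of_mem_erase hj)) hR0) h1 _).trans (le_of_eq ?_)
    refine Finset.sum_congr rfl fun j hj => ?_
    have hbj := hb j (Finset.mem_of_mem_erase hj)
    congr 2
    have hpos : 0 < b j / R := by positivity
    rw [div_eq_iff hpos.ne']
    have : ((b j / R : ℝ) : ℂ) * (ZMod.stdAddChar (t * (j0 : ZMod N)) * f j0 x) +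
          ZMod.stdAddChar (t * (j : ZMod N)) * f j x = ((b j / R : ℝ) : ℂ) * (ZMod.stdAddChar (t * (j0 : ZMod N)) *
          (f j0 x + ZMod.stdAddChar (t * ((j : ZMod N) - (j0 : ZMod N))) * (f j x * (R / b j : ℝ)))) := by
      have hc : (ZMod.stdAddChar (t * (j0 : ZMod N)) : ℂ) * ZMod.stdAddChar (t * ((j : ZMod N) - (j0 : ZMod N)))
          = ZMod.stdAddChar (t * (j : ZMod N)) := by
        rw [← AddChar.map_add_eq_mul]; congr 1; ring
      have h3 : ((b j / R : ℝ) : ℂ) * ((R / b j : ℝ) : ℂ) = 1 := by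
        rw [← Complex.ofReal_mul]
        have : b j / R * (R / b j) = 1 := by field_simp
        rw [this]; simp
      rw [← hc]
      linear_combination (-(ZMod.stdAddChar (t * (j0 : ZMod N)) : ℂ) * ZMod.stdAddChar (t * ((j : ZMod N) - (j0 : ZMod N))) * f j x) * h3
    rw [this, norm_mul, norm_mul, char_norm, one_mul, Complex.norm_real, Real.norm_of_nonneg hpos.le, mul_comm]
  calc _ ≤ ∑ x, ∑ t : ZMod N, ∑ j ∈ J.erase j0, (b j / R) *
        ‖f j0 x + ZMod.stdAddChar (t * ((j : ZMod N) - (j0 : ZMod N))) * (f j x * (R / b j : ℝ))‖ ^ (2 * s) :=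
        Finset.sum_le_sum fun x _ => Finset.sum_le_sum fun t _ => hpt x t
    _ = ∑ j ∈ J.erase j0, (b j / R) * ∑ x, ∑ t : ZMod N,
        ‖f j0 x + ZMod.stdAddChar (t * ((j : ZMod N) - (j0 : ZMod N))) * (f j x * (R / b j : ℝ))‖ ^ (2 * s) := by
        simp only [Finset.mul_sum]
        symm
        rw [Finset.sum_comm]
        refine Finset.sum_congr rfl fun x _ => Finset.sum_comm
    _ ≤ ∑ j ∈ J.erase j0, (b j / R) * (N * ((Fintype.card X : ℝ) * DD s (b j0) R)) := by
        refine Finset.sum_le_sum fun j hj => ?_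
        have hbj := hb j (Finset.mem_of_mem_erase hj)
        refine mul_le_mul_of_nonneg_left ?_ (by positivity)
        have hk : ((j : ZMod N) - (j0 : ZMod N)) ≠ 0 := by
          intro h
          rw [sub_eq_zero, ZMod.natCast_eq_natCast_iff', Nat.mod_eq_of_lt (hJ j (Finset.mem_of_mem_erase hj)),
            Nat.mod_eq_of_lt (hJ j0 hj0)] at h
          exact Finset.ne_of_mem_erase hj h
        simp only [two_term hN _ hk]
        rw [← Finset.mul_sum]
        refine mul_le_mul_of_nonneg_left ?_ (by positivity)
        unfold DD
        rw [Finset.sum_comm, Finset.mul_sum]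
        refine Finset.sum_le_sum fun m hm => ?_
        have hm' : m ≤ s := by rw [mem_range] at hm; omega
        have hg : Bd s (fun x => f j x * ((R / b j : ℝ) : ℂ)) R := by
          have := hf j (Finset.mem_of_mem_erase hj)
          unfold Bd at *
          simp only [norm_mul, mul_pow, Complex.norm_real, Real.norm_of_nonneg (by positivity : 0 ≤ R / b j)]
          rw [← Finset.sum_mul]
          calc _ ≤ ((Fintype.card X : ℝ) * b j ^ (2 * s)) * (R / b j) ^ (2 * s) := by gcongr
            _ = _ := by rw [mul_assoc, ← mul_pow, mul_div_cancel₀ _ hbj.ne']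
        have := Bd.holder hs (hb j0 hj0) hR0 (hf j0 hj0) hg (2 * (s - m)) (2 * m) (by omega)
        have e2 : ∀ u v : ℝ, ((s.choose m : ℝ) * u ^ (s - m) * v ^ m) ^ 2 =
            (s.choose m : ℝ) ^ 2 * (u ^ (2 * (s - m)) * v ^ (2 * m)) := by
          intro u v; rw [mul_comm 2 (s - m), mul_comm 2 m, pow_mul, pow_mul]; ring
        simp only [e2]
        rw [← Finset.mul_sum]
        calc _ ≤ (s.choose m : ℝ) ^ 2 * _ := mul_le_mul_of_nonneg_left this (by positivity)
          _ = _ := by ring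
    _ = _ := by rw [← Finset.sum_mul, ← Finset.sum_div, div_self hR0.ne', one_mul]

theorem shift_avg {ι : Type*} [Fintype ι] [DecidableEq ι] {N s : ℕ} [NeZero N] (i : ι) (J : Finset ℕ)
    (f : ℕ → (ι → ZMod N) → ℂ)
    (hf : ∀ j ∈ J, ∀ x t, f j (x + Pi.single i t) = ZMod.stdAddChar (t * (j : ZMod N)) * f j x) :
    ∑ x, ∑ t : ZMod N, ‖∑ j ∈ J, ZMod.stdAddChar (t * (j : ZMod N)) * f j x‖ ^ (2 * s) =
      N * ∑ x, ‖∑ j ∈ J, f j x‖ ^ (2 * s) := by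
  rw [Finset.sum_comm]
  have : ∀ t : ZMod N, ∑ x, ‖∑ j ∈ J, ZMod.stdAddChar (t * (j : ZMod N)) * f j x‖ ^ (2 * s) =
      ∑ x, ‖∑ j ∈ J, f j x‖ ^ (2 * s) := by
    intro t
    refine Fintype.sum_equiv (Equiv.addRight (Pi.single i t)) _ _ fun x => ?_
    congr 2
    refine Finset.sum_congr rfl fun j hj => ?_
    simp [hf j hj]
  simp [this]

theorem re_char_le {N : ℕ} [NeZero N] (t : ZMod N) :
    (ZMod.stdAddChar t : ℂ).re ≤ 1 - 8 * ((t.valMinAbs : ℝ) / N) ^ 2 := by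
  have hN : (0 : ℝ) < N := by exact_mod_cast Nat.pos_of_ne_zero (NeZero.ne N)
  have h1 : (ZMod.stdAddChar t : ℂ).re = Real.cos (2 * Real.pi * (t.valMinAbs / N)) := by
    conv_lhs => rw [← ZMod.coe_valMinAbs t]
    rw [ZMod.stdAddChar_coe]
    have : (2 * Real.pi * Complex.I * (t.valMinAbs : ℂ) / (N : ℂ)) =
        ((2 * Real.pi * ((t.valMinAbs : ℝ) / N) : ℝ) : ℂ) * Complex.I := by
      push_cast; ring
    rw [this, Complex.exp_ofReal_mul_I_re]
  rw [h1]
  have h2 : |(t.valMinAbs : ℝ)| ≤ N / 2 := by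
    have h := ZMod.natAbs_valMinAbs_le t
    have : ((t.valMinAbs.natAbs : ℕ) : ℝ) ≤ (N : ℝ) / 2 := by
      calc ((t.valMinAbs.natAbs : ℕ) : ℝ) ≤ ((N / 2 : ℕ) : ℝ) := by exact_mod_cast h
        _ ≤ _ := Nat.cast_div_le
    rw [Nat.cast_natAbs, Int.cast_abs] at this
    exact this
  have h3 : |2 * Real.pi * ((t.valMinAbs : ℝ) / N)| ≤ Real.pi := by
    rw [abs_mul, abs_of_pos (by positivity : (0 : ℝ) < 2 * Real.pi), abs_div, abs_of_pos hN]
    calc 2 * Real.pi * (|(t.valMinAbs : ℝ)| / N) ≤ 2 * Real.pi * ((N / 2) / N) := by gcongr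
      _ = Real.pi := by field_simp
  refine (Real.cos_le_one_sub_mul_cos_sq h3).trans (le_of_eq ?_)
  have := Real.pi_ne_zero
  field_simp
  ring

theorem DD_bound (s : ℕ) (hs : 0 < s) (σ r δ e : ℝ) (hσ : 0 ≤ σ) (hr : 0 ≤ r) (h0 : 0 < σ + r) (hδ : 0 < δ)
    (he : Real.exp (-(16 * s * σ * r * δ ^ 2 / (σ + r) ^ 2)) ≤ e) (he1 : e ≤ 1) :
    DD s σ r ≤ (σ + r) ^ (2 * s) * (e + (2 * δ + 1 / s) * (1 - e)) := by
  obtain ⟨N, hsN, hp⟩ := Nat.exists_infinite_primes (s + 1)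
  have : Fact N.Prime := ⟨hp⟩
  have hNR : (0 : ℝ) < N := by exact_mod_cast hp.pos
  have hsR : (0 : ℝ) < s := by exact_mod_cast hs
  have h1 := two_term (N := N) (s := s) (by omega) 1 one_ne_zero (σ : ℂ) (r : ℂ)
  simp only [mul_one, Complex.norm_real, Real.norm_of_nonneg hσ, Real.norm_of_nonneg hr] at h1
  have hsq : ∀ t : ZMod N, ‖(σ : ℂ) + ZMod.stdAddChar t * r‖ ^ 2 ≤ (σ + r) ^ 2 - 16 * σ * r * ((t.valMinAbs : ℝ) / N) ^ 2 := by
    intro t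
    have hre := re_char_le t
    have hn : Complex.normSq (ZMod.stdAddChar t : ℂ) = 1 := by
      rw [Complex.normSq_eq_norm_sq, AddChar.norm_apply]; norm_num
    rw [Complex.normSq_apply] at hn
    rw [← Complex.normSq_eq_norm_sq, Complex.normSq_apply]
    simp only [Complex.add_re, Complex.add_im, Complex.mul_re, Complex.mul_im, Complex.ofReal_re, Complex.ofReal_im]
    have hm := mul_le_mul_of_nonneg_left hre (mul_nonneg hσ hr)
    have hn2 : r ^ 2 * ((ZMod.stdAddChar t : ℂ).re * (ZMod.stdAddChar t : ℂ).re +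
      (ZMod.stdAddChar t : ℂ).im * (ZMod.stdAddChar t : ℂ).im) = r ^ 2 := by rw [hn, mul_one]
    generalize (ZMod.stdAddChar t : ℂ).re = p at *
    generalize (ZMod.stdAddChar t : ℂ).im = q at *
    linarith
  set bad : Finset (ZMod N) := univ.filter fun t => |(t.valMinAbs : ℝ)| < δ * N with hbad
  have hcard : (bad.card : ℝ) ≤ 2 * δ * N + 1 := by
    have hle : bad.card ≤ (Finset.Icc (-(⌊δ * N⌋₊ : ℤ)) (⌊δ * N⌋₊ : ℤ)).card := by
      refine Finset.card_le_card_of_injOn (fun t => t.valMinAbs) ?_ ?_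
      · intro t ht
        simp only [hbad, coe_filter, mem_univ, true_and, Set.mem_ofPred_eq] at ht
        simp only [coe_Icc, Set.mem_Icc]
        rw [← abs_le]
        have : ((t.valMinAbs.natAbs : ℕ) : ℝ) ≤ δ * N := by
          rw [Nat.cast_natAbs, Int.cast_abs]; exact ht.le
        have := Nat.le_floor this
        rw [Int.abs_eq_natAbs]
        exact_mod_cast this
      · intro a _ b _ h
        exact ZMod.injective_valMinAbs h
    have h2 : (Finset.Icc (-(⌊δ * N⌋₊ : ℤ)) (⌊δ * N⌋₊ : ℤ)).card = 2 * ⌊δ * N⌋₊ + 1 := by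
      rw [Int.card_Icc]; omega
    rw [h2] at hle
    have h3 : (⌊δ * N⌋₊ : ℝ) ≤ δ * N := Nat.floor_le (by positivity)
    calc (bad.card : ℝ) ≤ ((2 * ⌊δ * N⌋₊ + 1 : ℕ) : ℝ) := by exact_mod_cast hle
      _ ≤ _ := by push_cast; linarith
  have hterm : ∀ t : ZMod N, ‖(σ : ℂ) + ZMod.stdAddChar t * r‖ ^ (2 * s) ≤
      (σ + r) ^ (2 * s) * (e + if t ∈ bad then (1 - e) else 0) := by
    intro t
    split_ifs with ht
    · rw [add_sub_cancel, mul_one]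
      refine pow_le_pow_left₀ (norm_nonneg _) ?_ _
      refine abs_le_of_sq_le_sq' ?_ h0.le |>.2
      refine (hsq t).trans ?_
      have : 0 ≤ 16 * σ * r * ((t.valMinAbs : ℝ) / N) ^ 2 := by positivity
      linarith
    · rw [add_zero]
      have ht' : δ * N ≤ |(t.valMinAbs : ℝ)| := by
        simpa [hbad] using ht
      have h4 : δ ^ 2 ≤ ((t.valMinAbs : ℝ) / N) ^ 2 := by
        rw [← sq_abs ((t.valMinAbs : ℝ) / N), abs_div, abs_of_pos hNR]
        have : δ ≤ |(t.valMinAbs : ℝ)| / N := by rwa [le_div_iff₀ hNR]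
        gcongr
      have h5 : ‖(σ : ℂ) + ZMod.stdAddChar t * r‖ ^ 2 ≤ (σ + r) ^ 2 * Real.exp (-(16 * σ * r * δ ^ 2 / (σ + r) ^ 2)) := by
        refine (hsq t).trans ?_
        have := Real.add_one_le_exp (-(16 * σ * r * δ ^ 2 / (σ + r) ^ 2))
        have h6 : (σ + r) ^ 2 * (-(16 * σ * r * δ ^ 2 / (σ + r) ^ 2) + 1) ≤ (σ + r) ^ 2 * Real.exp (-(16 * σ * r * δ ^ 2 / (σ + r) ^ 2)) := by
          gcongr
        refine le_trans ?_ h6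
        have h7 : (σ + r) ^ 2 * (-(16 * σ * r * δ ^ 2 / (σ + r) ^ 2) + 1) = (σ + r) ^ 2 - 16 * σ * r * δ ^ 2 := by
          field_simp; ring
        rw [h7]
        have : 16 * σ * r * δ ^ 2 ≤ 16 * σ * r * ((t.valMinAbs : ℝ) / N) ^ 2 := by gcongr
        linarith
      calc ‖(σ : ℂ) + ZMod.stdAddChar t * r‖ ^ (2 * s) = (‖(σ : ℂ) + ZMod.stdAddChar t * r‖ ^ 2) ^ s := by rw [pow_mul]
        _ ≤ ((σ + r) ^ 2 * Real.exp (-(16 * σ * r * δ ^ 2 / (σ + r) ^ 2))) ^ s := by gcongr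
        _ = (σ + r) ^ (2 * s) * Real.exp (-(16 * s * σ * r * δ ^ 2 / (σ + r) ^ 2)) := by
          rw [mul_pow, ← pow_mul, ← Real.exp_nat_mul]; congr 2; ring
        _ ≤ _ := by gcongr
  have hsum := Finset.sum_le_sum fun t (_ : t ∈ (univ : Finset (ZMod N))) => hterm t
  rw [h1, ← Finset.mul_sum, Finset.sum_add_distrib, ← Finset.sum_filter] at hsum
  simp only [sum_const, card_univ, ZMod.card, nsmul_eq_mul, filter_mem_eq_inter, univ_inter] at hsum
  have h8 : (N : ℝ) * DD s σ r ≤ N * ((σ + r) ^ (2 * s) * (e + (2 * δ + 1 / s) * (1 - e))) := by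
    refine hsum.trans ?_
    have h9 : (bad.card : ℝ) * (1 - e) ≤ (N * (2 * δ + 1 / s)) * (1 - e) := by
      refine mul_le_mul_of_nonneg_right ?_ (by linarith)
      refine hcard.trans ?_
      have : (1 : ℝ) ≤ N * (1 / s) := by
        rw [mul_one_div, le_div_iff₀ hsR, one_mul]
        exact_mod_cast (by omega : s ≤ N)
      linarith
    calc (σ + r) ^ (2 * s) * (N * e + bad.card * (1 - e)) ≤ (σ + r) ^ (2 * s) * (N * e + (N * (2 * δ + 1 / s)) * (1 - e)) := by gcongr
      _ = _ := by ring
  exact le_of_mul_le_mul_left h8 hNR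

theorem DD_small (s : ℕ) (σ r : ℝ) (hσ : 0 ≤ σ) (hσ1 : σ ≤ 1) (hr : 0 ≤ r) (h : s * r ≤ 1 / 2) :
    DD s σ r ≤ σ ^ (2 * s) + 4 / 3 * (s * r) ^ 2 := by
  unfold DD
  rw [Finset.sum_range_succ', add_comm]
  have h0 : ((s.choose 0 : ℝ) * σ ^ (s - 0) * r ^ 0) ^ 2 = σ ^ (2 * s) := by
    simp [← pow_mul, mul_comm]
  rw [h0]
  gcongr
  set q := (s * r) ^ 2 with hq
  have hq0 : 0 ≤ q := by positivity
  have hq1 : q ≤ 1 / 4 := by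
    have : 0 ≤ (s : ℝ) * r := by positivity
    nlinarith
  have h1 : ∀ m ∈ range s, ((s.choose (m + 1) : ℝ) * σ ^ (s - (m + 1)) * r ^ (m + 1)) ^ 2 ≤ q * q ^ m := by
    intro m _
    have hc : (s.choose (m + 1) : ℝ) ≤ (s : ℝ) ^ (m + 1) := by exact_mod_cast Nat.choose_le_pow s (m + 1)
    have hp : σ ^ (s - (m + 1)) ≤ 1 := pow_le_one₀ hσ hσ1
    calc ((s.choose (m + 1) : ℝ) * σ ^ (s - (m + 1)) * r ^ (m + 1)) ^ 2 ≤ ((s : ℝ) ^ (m + 1) * 1 * r ^ (m + 1)) ^ 2 := by gcongr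
      _ = q * q ^ m := by rw [hq]; ring
  refine (Finset.sum_le_sum h1).trans ?_
  rw [← Finset.mul_sum, geom_sum_eq (by linarith), mul_comm]
  refine mul_le_mul_of_nonneg_right ?_ hq0
  have hqs : 0 ≤ q ^ s := by positivity
  rw [← neg_div_neg_eq, div_le_iff₀ (by linarith)]
  linarith

/-- The exponent parameter. -/
noncomputable def aa (s : ℕ) : ℝ := Real.logb 2 s / (64 * s)

/-- Numerical conditions valid for large `s`. -/
def Good (s : ℕ) : Prop :=
  100 ≤ s ∧ aa s ≤ 1 / 4 ∧ (8 * (s : ℝ)) ^ aa s ≤ 1.05 ∧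
  Real.exp (2 * Real.sqrt s * ((8 * (s : ℝ)) ^ aa s - 1 + aa s)) ≤ 1.01 ∧
  (s : ℝ) ^ (1 / 16 : ℝ) * (Real.exp (-(4 * (s : ℝ) ^ (1 / 4 : ℝ))) + (2 * (s : ℝ) ^ (-(1 / 8) : ℝ) + 1 / s)) ≤ 1

theorem holderSum (S : Finset ℕ) (hS : S.Nonempty) (a : ℝ) (ha : 0 ≤ a) (ha1 : a ≤ 1) (p q : ℕ → ℝ)
    (hp : ∀ j ∈ S, 0 < p j) (hq : ∀ j ∈ S, 0 < q j) :
    ∑ j ∈ S, p j ^ (1 - a) * q j ^ a ≤ (∑ j ∈ S, p j) ^ (1 - a) * (∑ j ∈ S, q j) ^ a := by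
  set P := ∑ j ∈ S, p j with hP
  set Q := ∑ j ∈ S, q j with hQ
  have hP0 : 0 < P := Finset.sum_pos hp hS
  have hQ0 : 0 < Q := Finset.sum_pos hq hS
  have h1 : ∀ j ∈ S, p j ^ (1 - a) * q j ^ a ≤ P ^ (1 - a) * Q ^ a * ((1 - a) * (p j / P) + a * (q j / Q)) := by
    intro j hj
    have hpj := hp j hj
    have hqj := hq j hj
    have := Real.geom_mean_le_arith_mean2_weighted (w₁ := 1 - a) (w₂ := a) (p₁ := p j / P) (p₂ := q j / Q)
      (by linarith) ha (by positivity) (by positivity) (by ring)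
    rw [Real.div_rpow hpj.le hP0.le, Real.div_rpow hqj.le hQ0.le, div_mul_div_comm, div_le_iff₀ (by positivity)] at this
    linarith
  refine (Finset.sum_le_sum h1).trans (le_of_eq ?_)
  rw [← Finset.mul_sum, Finset.sum_add_distrib, ← Finset.mul_sum, ← Finset.mul_sum, ← Finset.sum_div, ← Finset.sum_div,
    ← hP, ← hQ, div_self hP0.ne', div_self hQ0.ne']
  ring

theorem two_pow_aa (s : ℕ) (hs : 0 < s) (k : ℝ) : (2 : ℝ) ^ (aa s * (k * s)) = (s : ℝ) ^ (k / 64) := by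
  have hs' : (0 : ℝ) < s := by exact_mod_cast hs
  have : aa s * (k * s) = Real.logb 2 s * (k / 64) := by unfold aa; field_simp
  rw [this, Real.rpow_mul (by norm_num), Real.rpow_logb (by norm_num) (by norm_num) hs']

theorem aa_pos {s : ℕ} (hs : 2 ≤ s) : 0 < aa s := by
  unfold aa
  have : (1 : ℝ) < s := by exact_mod_cast hs
  have := Real.logb_pos (b := 2) (by norm_num) this
  positivity

set_option maxHeartbeats 2000000 in
theorem DD_twopt (s : ℕ) (hG : Good s) (x y : ℝ) (hxy : x + y = 1) (hy : 0 < y) (hx : (s : ℝ) ^ (-(1 / 2) : ℝ) ≤ x) :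
    DD s (x ^ (1 - aa s)) (y ^ (1 - aa s) * 2 ^ aa s) ≤ 1 := by
  obtain ⟨hs, ha4, hg, hexp, hB1⟩ := hG
  have hsR : (100 : ℝ) ≤ s := by exact_mod_cast hs
  have hs0 : (0 : ℝ) < s := by linarith
  have ha0 : 0 < aa s := aa_pos (by omega)
  have h2p := two_pow_aa s (by omega)
  set a := aa s with haa
  have hx0 : 0 < x := lt_of_lt_of_le (by positivity) hx
  have hx1 : x ≤ 1 := by linarith
  have hy1 : y ≤ 1 := by linarith
  set σ := x ^ (1 - a) with hσ
  set r := y ^ (1 - a) * 2 ^ a with hr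
  set g := (8 * (s : ℝ)) ^ a with hgdef
  have h2a : (1 : ℝ) ≤ 2 ^ a := Real.one_le_rpow (by norm_num) ha0.le
  have hσx : x ≤ σ := by
    rw [hσ]
    conv_lhs => rw [← Real.rpow_one x]
    exact Real.rpow_le_rpow_of_exponent_ge hx0 hx1 (by linarith)
  have hry : y ≤ r := by
    have : y ≤ y ^ (1 - a) := by
      conv_lhs => rw [← Real.rpow_one y]
      exact Real.rpow_le_rpow_of_exponent_ge hy hy1 (by linarith)
    rw [hr]
    nlinarith [Real.rpow_nonneg hy.le (1 - a)]
  have hσ0 : 0 < σ := by positivity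
  have hr0 : 0 < r := by positivity
  have hσ1 : σ ≤ 1 := Real.rpow_le_one hx0.le hx1 (by linarith)
  have h4a : σ + r ≤ 4 ^ a := by
    have h1 : x ^ (1 - a) * 1 ^ a + y ^ (1 - a) * 1 ^ a ≤ 2 ^ a := by
      have := holderSum {0, 1} (by simp) a ha0.le (by linarith) (fun j => if j = 0 then x else y) (fun _ => 1)
        (by intro j _; split_ifs <;> assumption) (by intros; norm_num)
      simpa [hxy, one_add_one_eq_two] using this
    have h2 : (4 : ℝ) ^ a = 2 ^ a * 2 ^ a := by rw [← Real.mul_rpow (by norm_num) (by norm_num)]; norm_num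
    rw [h2]
    simp only [Real.one_rpow, mul_one] at h1
    calc σ + r ≤ (σ + y ^ (1 - a)) * 2 ^ a := by rw [hr]; nlinarith
      _ ≤ _ := by gcongr
  have hsq2 : (σ + r) ^ 2 ≤ 2 := by
    calc (σ + r) ^ 2 ≤ (4 ^ a) ^ 2 := by gcongr
      _ = 16 ^ a := by rw [← Real.rpow_natCast, ← Real.rpow_mul (by norm_num), mul_comm, Real.rpow_mul (by norm_num)]; norm_num
      _ ≤ 16 ^ (1 / 4 : ℝ) := Real.rpow_le_rpow_of_exponent_le (by norm_num) ha4
      _ = 2 := by rw [show (16 : ℝ) = 2 ^ (4 : ℝ) by norm_num, ← Real.rpow_mul (by norm_num)]; norm_num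
  have hsqpos : 0 < (σ + r) ^ 2 := by positivity
  have hzge : ∀ δ : ℝ, 16 * s * (x * y) * δ ^ 2 / 2 ≤ 16 * s * σ * r * δ ^ 2 / (σ + r) ^ 2 := by
    intro δ
    have h1 : x * y ≤ σ * r := by gcongr
    calc 16 * s * (x * y) * δ ^ 2 / 2 ≤ 16 * s * (σ * r) * δ ^ 2 / 2 := by gcongr
      _ ≤ 16 * s * (σ * r) * δ ^ 2 / (σ + r) ^ 2 := by gcongr
      _ = _ := by ring
  have hhalf : (s : ℝ) ^ (-(1 / 2) : ℝ) = 1 / Real.sqrt s := by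
    rw [Real.rpow_neg hs0.le, Real.sqrt_eq_rpow, one_div]; norm_num
  have hsq10 : 10 ≤ Real.sqrt s := Real.le_sqrt_of_sq_le (by linarith)
  rcases le_or_gt ((s : ℝ) ^ (-(1 / 2) : ℝ)) y with hB | hB
  · -- B1
    have hxyge : (s : ℝ) ^ (-(1 / 2) : ℝ) / 2 ≤ x * y := by
      rcases le_total x y with h | h
      · have : 1 / 2 ≤ y := by linarith
        nlinarith
      · have : 1 / 2 ≤ x := by linarith
        nlinarith
    have hδ : (0 : ℝ) < (s : ℝ) ^ (-(1 / 8) : ℝ) := by positivity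
    have hz : 4 * (s : ℝ) ^ (1 / 4 : ℝ) ≤ 16 * s * σ * r * ((s : ℝ) ^ (-(1 / 8) : ℝ)) ^ 2 / (σ + r) ^ 2 := by
      refine le_trans ?_ (hzge _)
      have : 16 * s * ((s : ℝ) ^ (-(1 / 2) : ℝ) / 2) * ((s : ℝ) ^ (-(1 / 8) : ℝ)) ^ 2 / 2 = 4 * (s : ℝ) ^ (1 / 4 : ℝ) := by
        rw [← Real.rpow_natCast, ← Real.rpow_mul hs0.le]
        have : (s : ℝ) ^ (1 / 4 : ℝ) = s * (s : ℝ) ^ (-(1 / 2) : ℝ) * (s : ℝ) ^ (-(1 / 8) * ((2 : ℕ) : ℝ) : ℝ) := by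
          conv_rhs => rw [← Real.rpow_one s, ← Real.rpow_mul hs0.le, ← Real.rpow_mul hs0.le, ← Real.rpow_add hs0, ← Real.rpow_add hs0]
          norm_num
        rw [this]; ring
      rw [← this]
      gcongr
    have hb := DD_bound s (by omega) σ r _ (Real.exp (-(4 * (s : ℝ) ^ (1 / 4 : ℝ)))) hσ0.le hr0.le (by positivity) hδ
      (by gcongr) (by rw [Real.exp_le_one_iff]; have : 0 ≤ (s : ℝ) ^ (1 / 4 : ℝ) := by positivity
                      linarith)
    refine hb.trans (le_trans ?_ hB1)
    have hpow : (σ + r) ^ (2 * s) ≤ (s : ℝ) ^ (1 / 16 : ℝ) := by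
      calc (σ + r) ^ (2 * s) ≤ (4 ^ a) ^ (2 * s) := by gcongr
        _ = 2 ^ (a * (4 * s)) := by
          rw [show (4 : ℝ) = 2 ^ (2 : ℝ) by norm_num, ← Real.rpow_mul (by norm_num), ← Real.rpow_natCast, ← Real.rpow_mul (by norm_num)]
          congr 1; push_cast; norm_num; ring
        _ = (s : ℝ) ^ (1 / 16 : ℝ) := by rw [h2p]; norm_num
    have he0 := Real.exp_pos (-(4 * (s : ℝ) ^ (1 / 4 : ℝ)))
    have he1 : Real.exp (-(4 * (s : ℝ) ^ (1 / 4 : ℝ))) ≤ 1 := by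
      rw [Real.exp_le_one_iff]; have : 0 ≤ (s : ℝ) ^ (1 / 4 : ℝ) := by positivity
      linarith
    have hc : 0 ≤ 2 * (s : ℝ) ^ (-(1 / 8) : ℝ) + 1 / s := by positivity
    refine mul_le_mul hpow ?_ ?_ (by positivity)
    · nlinarith
    · have : 0 ≤ (2 * (s : ℝ) ^ (-(1 / 8) : ℝ) + 1 / s) * (1 - Real.exp (-(4 * (s : ℝ) ^ (1 / 4 : ℝ)))) := mul_nonneg hc (by linarith)
      linarith
  · have hy10 : y ≤ 1 / 10 := by
      refine hB.le.trans ?_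
      rw [hhalf]; gcongr
    rcases le_or_gt (1 / (4 * (s : ℝ))) y with hB2 | hB2
    · -- B2b
      have hσ2 : σ ≤ 1 - (1 - a) * y := by
        have := rpow_one_add_le_one_add_mul_self (s := -y) (p := 1 - a) (by linarith) (by linarith) (by linarith)
        rw [hσ, show x = 1 + -y by linarith]
        linarith
      have hr2 : r ≤ y * g := by
        have h1 : y ^ (1 - a) * 2 ^ a = y * (2 / y) ^ a := by
          rw [Real.rpow_sub hy, Real.rpow_one, Real.div_rpow (by norm_num) hy.le]; ring
        rw [hr, h1, hgdef]
        gcongr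
        rw [div_le_iff₀ hy]
        rw [div_le_iff₀ (by positivity)] at hB2
        linarith
      have hg1 : 1 ≤ g := Real.one_le_rpow (by linarith) ha0.le
      have hpow : (σ + r) ^ (2 * s) ≤ 1.01 := by
        have h1 : σ + r ≤ Real.exp (y * (g - 1 + a)) := by
          have := Real.add_one_le_exp (y * (g - 1 + a))
          nlinarith
        calc (σ + r) ^ (2 * s) ≤ (Real.exp (y * (g - 1 + a))) ^ (2 * s) := by gcongr
          _ = Real.exp (2 * s * y * (g - 1 + a)) := by rw [← Real.exp_nat_mul]; congr 1; push_cast; ring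
          _ ≤ Real.exp (2 * Real.sqrt s * (g - 1 + a)) := by
            have : s * y ≤ Real.sqrt s := by
              rw [hhalf] at hB
              calc s * y ≤ s * (1 / Real.sqrt s) := by gcongr
                _ = Real.sqrt s := by rw [mul_one_div, Real.div_sqrt]
            have h3 : 0 ≤ g - 1 + a := by linarith
            refine Real.exp_le_exp.2 ?_
            nlinarith
          _ ≤ _ := hexp
      have hsxy : 0.225 ≤ s * (x * y) := by
        have h1 : 1 / 4 ≤ s * y := by
          rw [div_le_iff₀ (by positivity)] at hB2; linarith
        nlinarith
      have hb := DD_bound s (by omega) σ r 0.3 0.87 hσ0.le hr0.le (by positivity) (by norm_num) (by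
          have h1 := hzge 0.3
          have h2 : (0.16 : ℝ) ≤ 16 * s * (x * y) * 0.3 ^ 2 / 2 := by nlinarith
          have h3 := Real.add_one_le_exp (0.16 : ℝ)
          calc _ ≤ Real.exp (-0.16) := Real.exp_le_exp.2 (by linarith)
            _ ≤ 0.87 := by
              rw [Real.exp_neg]
              refine (inv_anti₀ (by norm_num) h3).trans ?_
              norm_num) (by norm_num)
      refine hb.trans ?_
      have h1s : 1 / (s : ℝ) ≤ 0.01 := by rw [div_le_iff₀ hs0]; linarith
      calc (σ + r) ^ (2 * s) * (0.87 + (2 * 0.3 + 1 / s) * (1 - 0.87)) ≤ 1.01 * (0.87 + (2 * 0.3 + 0.01) * (1 - 0.87)) := by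
            have : (0 : ℝ) ≤ 0.87 + (2 * 0.3 + 1 / s) * (1 - 0.87) := by
              have : (0 : ℝ) < 1 / s := by positivity
              nlinarith
            refine mul_le_mul hpow ?_ this (by norm_num)
            linarith
        _ ≤ 1 := by norm_num
    · -- B2a
      have hsy : s * y ≤ 1 / 4 := by
        rw [lt_div_iff₀ (by positivity)] at hB2; linarith
      have h4s : (0 : ℝ) < 1 / (4 * s) := by positivity
      have hrr : s * r ^ 2 ≤ 3 / 5 * y := by
        have e1 : r ^ 2 = y * (y ^ (1 - 2 * a) * (2 ^ a) ^ 2) := by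
          rw [hr, mul_pow, ← mul_assoc]
          congr 1
          rw [← Real.rpow_natCast, ← Real.rpow_mul hy.le]
          conv_rhs => rw [← Real.rpow_one y, ← Real.rpow_mul hy.le, ← Real.rpow_add hy]
          congr 1; push_cast; ring
        have e2 : (1 / (4 * s) : ℝ) ^ (1 - 2 * a) * (2 ^ a) ^ 2 = 1 / (4 * s) * g ^ 2 := by
          have e8 : g = 2 ^ a * (4 * (s : ℝ)) ^ a := by
            rw [hgdef, ← Real.mul_rpow (by norm_num) (by positivity)]; congr 1; ring
          rw [Real.rpow_sub h4s, Real.rpow_one, mul_comm (2 : ℝ) a, Real.rpow_mul h4s.le, e8,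
            Real.div_rpow (by norm_num) (by positivity), Real.one_rpow, Real.rpow_ofNat]
          have h4ne : (4 * (s : ℝ)) ^ a ≠ 0 := by positivity
          generalize (4 * (s : ℝ)) ^ a = u at *
          field_simp
        have e3 : y ^ (1 - 2 * a) ≤ (1 / (4 * s) : ℝ) ^ (1 - 2 * a) := by
          exact Real.rpow_le_rpow hy.le hB2.le (by linarith)
        have e4 : y ^ (1 - 2 * a) * (2 ^ a) ^ 2 ≤ 1 / (4 * s) * g ^ 2 := by
          rw [← e2]; gcongr
        rw [e1]
        have hg0 : 0 ≤ g := by positivity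
        calc s * (y * (y ^ (1 - 2 * a) * (2 ^ a) ^ 2)) ≤ s * (y * (1 / (4 * s) * g ^ 2)) := by gcongr
          _ = g ^ 2 / 4 * y := by field_simp
          _ ≤ 3 / 5 * y := mul_le_mul_of_nonneg_right (by nlinarith) hy.le
      have hsr : s * r ≤ 1 / 2 := by
        have : (s * r) ^ 2 ≤ (1 / 2) ^ 2 := by nlinarith
        exact abs_le_of_sq_le_sq' this (by norm_num) |>.2
      refine (DD_small s σ r hσ0.le hσ1 hr0.le hsr).trans ?_
      have h1 : σ ^ (2 * s) ≤ 1 - 4 / 5 * (s * y) := by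
        have e1 : σ ^ (2 * s) ≤ x ^ s := by
          rw [hσ, ← Real.rpow_natCast, ← Real.rpow_mul hx0.le, ← Real.rpow_natCast]
          refine Real.rpow_le_rpow_of_exponent_ge hx0 hx1 ?_
          push_cast
          nlinarith
        have e2 : x ^ s ≤ Real.exp (-(s * y)) := by
          have : x ≤ Real.exp (-y) := by have := Real.add_one_le_exp (-y); linarith
          calc x ^ s ≤ (Real.exp (-y)) ^ s := by gcongr
            _ = _ := by rw [← Real.exp_nat_mul]; congr 1; ring
        have e3 : Real.exp (-(s * y)) ≤ 1 - 4 / 5 * (s * y) := by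
          rw [Real.exp_neg]
          have h3 := Real.add_one_le_exp (s * y)
          have h0 : 0 < s * y := by positivity
          refine (inv_anti₀ (by linarith) h3).trans ?_
          rw [inv_le_iff_one_le_mul₀ (by linarith)]
          nlinarith
        exact e1.trans (e2.trans e3)
      nlinarith

theorem RI (s : ℕ) (hG : Good s) (J : Finset ℕ) (hJ : J.Nonempty) (p q : ℕ → ℝ) (hp : ∀ j ∈ J, 0 < p j)
    (hp1 : ∑ j ∈ J, p j = 1)
    (hq : ∀ j ∈ J, 0 < q j) (hq1 : ∀ j ∈ J, q j ≤ 1) (hq2 : ∑ j ∈ J, q j ≤ 2) :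
    ((∑ j ∈ J, p j ^ (1 - aa s) * q j ^ aa s) ^ (2 * s - 2) * ∑ j ∈ J, (p j ^ (1 - aa s) * q j ^ aa s) ^ 2 ≤ 1) ∨
    ∃ j0 ∈ J, (J.erase j0).Nonempty → DD s (p j0 ^ (1 - aa s) * q j0 ^ aa s)
      (∑ j ∈ J.erase j0, p j ^ (1 - aa s) * q j ^ aa s) ≤ 1 := by
  have hG' := hG
  obtain ⟨hs, ha4, -, -, -⟩ := hG'
  have ha0 : 0 < aa s := aa_pos (by omega)
  have hs0 : (0 : ℝ) < s := by exact_mod_cast (by omega : 0 < s)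
  have hs1 : (1 : ℝ) ≤ s := by exact_mod_cast (by omega : 1 ≤ s)
  have h2p := two_pow_aa s (by omega)
  set a := aa s with haa
  have hw0 : ∀ j ∈ J, 0 ≤ p j ^ (1 - a) * q j ^ a := fun j hj => by
    have := hp j hj; have := hq j hj; positivity
  by_cases hA : ∀ j ∈ J, p j ^ (1 - a) * q j ^ a ≤ (s : ℝ) ^ (-(1 / 4) : ℝ)
  · left
    set W := ∑ j ∈ J, p j ^ (1 - a) * q j ^ a with hW
    have hW0 : 0 ≤ W := Finset.sum_nonneg hw0
    have hW2 : W ≤ 2 ^ a := by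
      have := holderSum J hJ a ha0.le (by linarith) p q hp hq
      rw [hp1, Real.one_rpow, one_mul] at this
      refine this.trans (Real.rpow_le_rpow (Finset.sum_nonneg fun j hj => (hq j hj).le) hq2 ha0.le)
    have h2a : (1 : ℝ) ≤ 2 ^ a := Real.one_le_rpow (by norm_num) ha0.le
    have h1 : ∑ j ∈ J, (p j ^ (1 - a) * q j ^ a) ^ 2 ≤ (s : ℝ) ^ (-(1 / 4) : ℝ) * W := by
      rw [hW, Finset.mul_sum]
      refine Finset.sum_le_sum fun j hj => ?_
      rw [sq]
      exact mul_le_mul_of_nonneg_right (hA j hj) (hw0 j hj)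
    calc W ^ (2 * s - 2) * ∑ j ∈ J, (p j ^ (1 - a) * q j ^ a) ^ 2 ≤ (2 ^ a) ^ (2 * s - 2) * ((s : ℝ) ^ (-(1 / 4) : ℝ) * 2 ^ a) := by
          refine mul_le_mul (by gcongr) (h1.trans (by gcongr)) (Finset.sum_nonneg fun j _ => sq_nonneg _) (by positivity)
      _ = (2 ^ a) ^ (2 * s - 1) * (s : ℝ) ^ (-(1 / 4) : ℝ) := by
          rw [show 2 * s - 1 = (2 * s - 2) + 1 by omega, pow_succ]; ring
      _ ≤ (2 ^ a) ^ (2 * s) * (s : ℝ) ^ (-(1 / 4) : ℝ) := by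
          gcongr ?_ * _
          exact pow_le_pow_right₀ h2a (by omega)
      _ = (s : ℝ) ^ (2 / 64 : ℝ) * (s : ℝ) ^ (-(1 / 4) : ℝ) := by
          rw [← h2p, ← Real.rpow_natCast, ← Real.rpow_mul (by norm_num)]; push_cast; rfl
      _ ≤ 1 := by
          rw [← Real.rpow_add hs0]
          exact Real.rpow_le_one_of_one_le_of_nonpos hs1 (by norm_num)
  · right
    push Not at hA
    obtain ⟨j0, hj0, hbig⟩ := hA
    refine ⟨j0, hj0, fun hne => ?_⟩
    set y := ∑ j ∈ J.erase j0, p j with hy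
    have hy0 : 0 < y := Finset.sum_pos (fun j hj => hp j (Finset.mem_of_mem_erase hj)) hne
    have hxy : p j0 + y = 1 := by rw [hy, Finset.add_sum_erase _ _ hj0, hp1]
    have hpj := hp j0 hj0
    have hqj := hq j0 hj0
    have hw1 : p j0 ^ (1 - a) * q j0 ^ a ≤ p j0 ^ (1 - a) :=
      mul_le_of_le_one_right (by positivity) (Real.rpow_le_one hqj.le (hq1 j0 hj0) ha0.le)
    have htail : ∑ j ∈ J.erase j0, p j ^ (1 - a) * q j ^ a ≤ y ^ (1 - a) * 2 ^ a := by
      refine (holderSum _ hne a ha0.le (by linarith) p q (fun j hj => hp j (Finset.mem_of_mem_erase hj))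
        (fun j hj => hq j (Finset.mem_of_mem_erase hj))).trans ?_
      have : ∑ j ∈ J.erase j0, q j ≤ 2 := by
        refine le_trans ?_ hq2
        rw [← Finset.add_sum_erase _ _ hj0]; linarith
      rw [← hy]
      gcongr
      exact Finset.sum_nonneg fun j hj => (hq j (Finset.mem_of_mem_erase hj)).le
    refine (DD_mono s (hw0 j0 hj0) (Finset.sum_nonneg fun j hj => hw0 j (Finset.mem_of_mem_erase hj)) hw1 htail).trans ?_
    refine DD_twopt s hG (p j0) y hxy hy0 ?_
    by_contra hlt
    push Not at hlt
    have : p j0 ^ (1 - a) ≤ (s : ℝ) ^ (-(1 / 4) : ℝ) := by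
      calc p j0 ^ (1 - a) ≤ p j0 ^ (1 / 2 : ℝ) := Real.rpow_le_rpow_of_exponent_ge hpj (by linarith) (by linarith)
        _ ≤ ((s : ℝ) ^ (-(1 / 2) : ℝ)) ^ (1 / 2 : ℝ) := by gcongr
        _ = _ := by rw [← Real.rpow_mul hs0.le]; norm_num
    linarith

theorem good_large (s : ℕ) (hs : 10 ^ 64 ≤ s) : Good s := by
  have hsR : (10 : ℝ) ^ 64 ≤ s := by exact_mod_cast hs
  have hs0 : (0 : ℝ) < s := lt_of_lt_of_le (by norm_num) hsR
  obtain ⟨v, hv, hv16⟩ : ∃ v : ℝ, 10000 ≤ v ∧ v = (s : ℝ) ^ (1 / 16 : ℝ) := by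
    refine ⟨_, ?_, rfl⟩
    rw [show (10000 : ℝ) = ((10 : ℝ) ^ 64) ^ (1 / 16 : ℝ) by
      rw [show (10 : ℝ) ^ 64 = 10000 ^ (16 : ℝ) by norm_num, ← Real.rpow_mul (by norm_num)]; norm_num]
    gcongr
  have hv0 : 0 < v := by linarith
  have hsv : (s : ℝ) = v ^ 16 := by
    rw [hv16, ← Real.rpow_natCast, ← Real.rpow_mul hs0.le]; norm_num
  have h4 : (s : ℝ) ^ (1 / 4 : ℝ) = v ^ 4 := by
    rw [hv16, ← Real.rpow_natCast, ← Real.rpow_mul hs0.le]; norm_num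
  have h8 : (s : ℝ) ^ (-(1 / 8) : ℝ) = (v ^ 2)⁻¹ := by
    rw [hv16, ← Real.rpow_natCast, ← Real.rpow_mul hs0.le, ← Real.rpow_neg hs0.le]; norm_num
  have hsq : Real.sqrt s = v ^ 8 := by
    rw [hsv, show v ^ 16 = (v ^ 8) ^ 2 by ring, Real.sqrt_sq (by positivity)]
  have hlogv : Real.log v ≤ v := (Real.log_le_sub_one_of_pos hv0).trans (by linarith)
  have hlogs : Real.log s ≤ 16 * v := by
    rw [hsv, Real.log_pow]; push_cast; linarith
  have hlog8s : Real.log (8 * s) ≤ 17 * v := by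
    rw [Real.log_mul (by norm_num) hs0.ne']
    have := Real.log_le_sub_one_of_pos (by norm_num : (0 : ℝ) < 8)
    linarith
  have ha0 : 0 < aa s := aa_pos (by have : 2 ≤ 10 ^ 64 := by norm_num
                                    exact this.trans hs)
  have hlog2 := Real.log_two_gt_d9
  have ha : aa s ≤ (v ^ 15)⁻¹ / 2 := by
    unfold aa Real.logb
    rw [hsv] at *
    rw [div_div, div_le_iff₀ (by positivity)]
    calc Real.log (v ^ 16) ≤ 16 * v := hlogs
      _ ≤ 16 * v * (2 * Real.log 2) := by nlinarith
      _ = (v ^ 15)⁻¹ / 2 * (Real.log 2 * (64 * v ^ 16)) := by field_simp; norm_num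
  have hl0 : 0 ≤ Real.log (8 * s) := Real.log_nonneg (by linarith [show (1 : ℝ) ≤ 10 ^ 64 by norm_num])
  have hal : aa s * Real.log (8 * s) ≤ 9 * (v ^ 14)⁻¹ := by
    calc aa s * Real.log (8 * s) ≤ ((v ^ 15)⁻¹ / 2) * (17 * v) := by gcongr
      _ = 8.5 * (v ^ 14)⁻¹ := by field_simp; norm_num
      _ ≤ _ := by gcongr; norm_num
  have hinv : v⁻¹ ≤ 1 / 10000 := by rw [one_div]; gcongr
  have hvi : ∀ k : ℕ, 1 ≤ k → (v ^ k)⁻¹ ≤ 1 / 10000 := by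
    intro k hk
    rw [← inv_pow]
    refine (pow_le_of_le_one (by positivity) (by linarith) (by omega)).trans hinv
  have hg : (8 * (s : ℝ)) ^ aa s - 1 ≤ 18 * (v ^ 14)⁻¹ := by
    rw [Real.rpow_def_of_pos (by positivity), mul_comm]
    have hx0 : 0 ≤ aa s * Real.log (8 * s) := by positivity
    have h14 := hvi 14 (by norm_num)
    have := Real.abs_exp_sub_one_le (x := aa s * Real.log (8 * s)) (by rw [abs_of_nonneg hx0]; linarith)
    rw [abs_of_nonneg hx0] at this
    linarith [le_abs_self (Real.exp (aa s * Real.log (8 * s)) - 1)]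
  refine ⟨le_trans (by norm_num) hs, ?_, ?_, ?_, ?_⟩
  · linarith [hvi 15 (by norm_num)]
  · linarith [hvi 14 (by norm_num)]
  · rw [hsq]
    have hx : 2 * v ^ 8 * ((8 * (s : ℝ)) ^ aa s - 1 + aa s) ≤ 0.0045 := by
      calc 2 * v ^ 8 * ((8 * (s : ℝ)) ^ aa s - 1 + aa s) ≤ 2 * v ^ 8 * (18 * (v ^ 14)⁻¹ + (v ^ 15)⁻¹ / 2) := by gcongr
        _ = 36 * (v ^ 6)⁻¹ + (v ^ 7)⁻¹ := by field_simp; norm_num; ring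
        _ ≤ 0.0045 := by linarith [hvi 6 (by norm_num), hvi 7 (by norm_num)]
    refine (Real.exp_le_exp.2 hx).trans ?_
    have := Real.abs_exp_sub_one_le (x := 0.0045) (by norm_num [abs_of_nonneg])
    have h2 := le_abs_self (Real.exp 0.0045 - 1)
    rw [abs_of_nonneg (by norm_num : (0 : ℝ) ≤ 0.0045)] at this
    linarith
  · rw [h4, h8, ← hv16, hsv]
    have h1 : Real.exp (-(4 * v ^ 4)) ≤ (v ^ 2)⁻¹ := by
      rw [Real.exp_neg]
      refine inv_anti₀ (by positivity) ?_
      have := Real.add_one_le_exp (4 * v ^ 4)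
      nlinarith [sq_nonneg (v ^ 2 - 1)]
    have h2 : 1 / v ^ 16 ≤ (v ^ 2)⁻¹ := by
      rw [one_div]
      refine inv_anti₀ (by positivity) (pow_le_pow_right₀ (by linarith) (by norm_num))
    calc v * (Real.exp (-(4 * v ^ 4)) + (2 * (v ^ 2)⁻¹ + 1 / v ^ 16)) ≤ v * ((v ^ 2)⁻¹ + (2 * (v ^ 2)⁻¹ + (v ^ 2)⁻¹)) := by gcongr
      _ = 4 * v⁻¹ := by field_simp; norm_num
      _ ≤ 1 := by linarith

/-- Exponential sum attached to a family of characters. -/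
noncomputable def fS {X : Type*} [AddCommGroup X] (e : ℤ → AddChar X ℂ) (S : Finset ℤ) (x : X) : ℂ :=
  ∑ a ∈ S, e a x

/-- Signs: `+1` on the left block, `-1` on the right block. -/
def sgn {s : ℕ} : Fin s ⊕ Fin s → ℤ := Sum.elim (fun _ => 1) (fun _ => -1)

open Classical in
/-- Solutions of the character equation. -/
noncomputable def sol {X I : Type*} [AddCommGroup X] [Fintype I] [DecidableEq I]
    (e : ℤ → AddChar X ℂ) (ε : I → ℤ) (S : I → Finset ℤ) : Finset (I → ℤ) :=
  (Fintype.piFinset S).filter fun φ => ∏ i, e (φ i) ^ ε i = 1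

theorem mem_sol {X I : Type*} [AddCommGroup X] [Fintype I] [DecidableEq I]
    (e : ℤ → AddChar X ℂ) (ε : I → ℤ) (S : I → Finset ℤ) (φ : I → ℤ) :
    φ ∈ sol e ε S ↔ (∀ i, φ i ∈ S i) ∧ ∏ i, e (φ i) ^ ε i = 1 := by
  classical
  unfold sol
  rw [mem_filter, Fintype.mem_piFinset]

theorem energy {X I : Type*} [AddCommGroup X] [Fintype X] [Fintype I] [DecidableEq I]
    (e : ℤ → AddChar X ℂ) (ε : I → ℤ) (S : I → Finset ℤ) :
    ∑ x, ∏ i, ∑ a ∈ S i, (e a ^ ε i) x =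
      (Fintype.card X : ℂ) * (sol e ε S).card := by
  classical
  have h1 : ∀ x, ∏ i, ∑ a ∈ S i, (e a ^ ε i) x = ∑ φ ∈ Fintype.piFinset S, (∏ i, e (φ i) ^ ε i) x := by
    intro x
    rw [Finset.prod_univ_sum]
    refine Finset.sum_congr rfl fun φ _ => ?_
    rw [AddChar.prod_apply]
  simp only [h1]
  rw [Finset.sum_comm]
  have h2 : ∀ φ : I → ℤ, ∑ x, (∏ i, e (φ i) ^ ε i) x = if ∏ i, e (φ i) ^ ε i = 1 then (Fintype.card X : ℂ) else 0 := by
    intro φ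
    rw [AddChar.sum_eq_ite]
    rfl
  simp only [h2]
  unfold sol
  rw [← Finset.sum_filter, Finset.sum_const, nsmul_eq_mul, mul_comm]

theorem norm_fS_sgn {X : Type*} [AddCommGroup X] [Finite X] {s : ℕ} (e : ℤ → AddChar X ℂ) (S : Finset ℤ) (i : Fin s ⊕ Fin s) (x : X) :
    ‖∑ a ∈ S, (e a ^ sgn i) x‖ = ‖fS e S x‖ := by
  rcases i with i | i
  · simp [sgn, fS]
  · simp only [sgn, fS, Sum.elim_inr, zpow_neg, zpow_one, AddChar.inv_apply, AddChar.map_neg_eq_conj]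
    rw [← map_sum, RCLike.norm_conj]

theorem prod_sgn {X : Type*} [AddCommGroup X] [Finite X] {s : ℕ} (e : ℤ → AddChar X ℂ) (S : Finset ℤ) (x : X) :
    ∏ i : Fin s ⊕ Fin s, ∑ a ∈ S, (e a ^ sgn i) x = ((‖fS e S x‖ ^ (2 * s) : ℝ) : ℂ) := by
  rw [Fintype.prod_sum_type]
  simp only [sgn, Sum.elim_inl, Sum.elim_inr, zpow_neg, zpow_one, AddChar.inv_apply, AddChar.map_neg_eq_conj, prod_const, card_univ, Fintype.card_fin]
  rw [← map_sum, pow_mul]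
  have : fS e S x = ∑ a ∈ S, e a x := rfl
  rw [← this, ← mul_pow, Complex.mul_conj, Complex.normSq_eq_norm_sq]
  push_cast; rfl

theorem energy_eq {X : Type*} [AddCommGroup X] [Fintype X] (s : ℕ) (e : ℤ → AddChar X ℂ) (S : Finset ℤ) :
    ∑ x, ‖fS e S x‖ ^ (2 * s) = (Fintype.card X : ℝ) *
      (sol e (sgn (s := s)) fun _ => S).card := by
  have := energy e (sgn (s := s)) (fun _ => S)
  simp only [prod_sgn] at this
  exact_mod_cast this

theorem energy_le {X : Type*} [AddCommGroup X] [Fintype X] {s : ℕ} (e : ℤ → AddChar X ℂ) (S : Fin s ⊕ Fin s → Finset ℤ) :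
    (Fintype.card X : ℝ) *
      (sol e (sgn (s := s)) S).card ≤ ∑ x, ∏ i, ‖fS e (S i) x‖ := by
  have h := energy e (sgn (s := s)) S
  have h2 : (Fintype.card X : ℝ) *
      (sol e (sgn (s := s)) S).card = ‖∑ x, ∏ i, ∑ a ∈ S i, (e a ^ sgn i) x‖ := by
    rw [h]; simp
  rw [h2]
  refine (norm_sum_le _ _).trans (Finset.sum_le_sum fun x _ => ?_)
  rw [norm_prod]
  simp only [norm_fS_sgn, le_refl]

/-- counting tuples by the energy. -/
theorem count_le {X : Type*} [AddCommGroup X] [Fintype X] (s : ℕ) (e : ℤ → AddChar X ℂ) (S : Finset ℤ)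
    (P : (Fin s → ℤ) × (Fin s → ℤ) → Prop)
    (hP : ∀ f, P f → (∀ i, f.1 i ∈ S) ∧ (∀ i, f.2 i ∈ S) ∧ ∏ i, e (f.1 i) = ∏ i, e (f.2 i)) :
    (Fintype.card X : ℝ) * (Set.ncard {f | P f}) ≤ ∑ x, ‖fS e S x‖ ^ (2 * s) := by
  rw [energy_eq]
  have : Set.ncard {f | P f} ≤ (sol e (sgn (s := s)) fun _ => S).card := by
    rw [← Set.ncard_coe_finset]
    refine Set.ncard_le_ncard_of_injOn (fun f => Sum.elim f.1 f.2) ?_ ?_ (Finset.finite_toSet _)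
    · intro f hf
      obtain ⟨h1, h2, h3⟩ := hP f hf
      rw [Finset.mem_coe, mem_sol]
      refine ⟨?_, ?_⟩
      · rintro (i | i)
        · exact h1 i
        · exact h2 i
      · rw [Fintype.prod_sum_type]
        simp [sgn, h3]
    · rintro ⟨f1, f2⟩ _ ⟨g1, g2⟩ _ h
      simp only [Sum.elim_eq_iff] at h
      simp [h.1, h.2]
  gcongr

theorem char_map_sum {X I : Type*} [AddCommGroup X] (ψ : AddChar X ℂ) (S : Finset I) (f : I → X) :
    ψ (∑ i ∈ S, f i) = ∏ i ∈ S, ψ (f i) := by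
  classical
  induction S using Finset.induction_on with
  | empty => simp
  | insert a S ha ih => rw [Finset.sum_insert ha, Finset.prod_insert ha, AddChar.map_add_eq_mul, ih]

/-- additive characters -/
noncomputable def eA (M : ℕ) [NeZero M] (a : ℤ) : AddChar (ZMod M) ℂ := AddChar.mulShift ZMod.stdAddChar (a : ZMod M)

theorem eA_prod (M : ℕ) [NeZero M] {I : Type*} [Fintype I] (φ ε : I → ℤ) (x : ZMod M) :
    (∏ i, eA M (φ i) ^ ε i) x = ZMod.stdAddChar (((∑ i, ε i * φ i : ℤ) : ZMod M) * x) := by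
  rw [AddChar.prod_apply]
  push_cast
  rw [Finset.sum_mul, char_map_sum]
  refine Finset.prod_congr rfl fun i _ => ?_
  rw [AddChar.zpow_apply]
  unfold eA
  rw [AddChar.mulShift_apply]
  rw [← AddChar.map_zsmul_eq_zpow, zsmul_eq_mul, mul_assoc]

theorem eA_prod_eq_one (M : ℕ) [NeZero M] {I : Type*} [Fintype I] (φ ε : I → ℤ) (hM : |∑ i, ε i * φ i| < M)
    (h : ∏ i, eA M (φ i) ^ ε i = 1) : ∑ i, ε i * φ i = 0 := by
  have h1 := eA_prod M φ ε 1
  rw [h, mul_one, AddChar.one_apply] at h1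
  have h2 : ((∑ i, ε i * φ i : ℤ) : ZMod M) = 0 := by
    apply ZMod.injective_stdAddChar
    rw [← h1, AddChar.map_zero_eq_one]
  rw [ZMod.intCast_zmod_eq_zero_iff_dvd] at h2
  exact Int.eq_zero_of_abs_lt_dvd h2 hM

theorem exists_pair {I : Type*} [Fintype I] [DecidableEq I] [Nonempty I] (p : ℕ) [Fact p.Prime] (φ ε : I → ℤ) (hε : ∀ i, ε i = 1 ∨ ε i = -1)
    (hφ : ∀ i, φ i ≠ 0) (h : ∑ i, ε i * φ i = 0) : ∃ α β, α ≠ β ∧ padicValInt p (φ α) = padicValInt p (φ β) := by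
  by_contra hc
  push Not at hc
  obtain ⟨i0, -, hi0⟩ := Finset.exists_min_image univ (fun i => padicValInt p (φ i)) Finset.univ_nonempty
  have h1 : (p : ℤ) ^ (padicValInt p (φ i0) + 1) ∣ ∑ i ∈ univ.erase i0, ε i * φ i := by
    refine Finset.dvd_sum fun i hi => Dvd.dvd.mul_left ?_ _
    rw [padicValInt_dvd_iff]
    right
    have := hi0 i (mem_univ _)
    have := hc i i0 (Finset.ne_of_mem_erase hi)
    omega
  have h2 : (p : ℤ) ^ (padicValInt p (φ i0) + 1) ∣ ε i0 * φ i0 := by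
    rw [← Finset.add_sum_erase _ _ (mem_univ i0)] at h
    have : ε i0 * φ i0 = - ∑ i ∈ univ.erase i0, ε i * φ i := by linarith
    rw [this]; exact (dvd_neg).2 h1
  have h3 : (p : ℤ) ^ (padicValInt p (φ i0) + 1) ∣ φ i0 := by
    rcases hε i0 with h | h <;> rw [h] at h2 <;> simpa using h2
  rw [padicValInt_dvd_iff] at h3
  rcases h3 with h3 | h3
  · exact hφ _ h3
  · omega

theorem card_cover {Ω α β : Type*} (T : Finset Ω) (P : Finset α) (J : Finset β) (U : α → β → Finset Ω)
    (h : ∀ φ ∈ T, ∃ a ∈ P, ∃ j ∈ J, φ ∈ U a j) : T.card ≤ ∑ a ∈ P, ∑ j ∈ J, (U a j).card := by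
  classical
  refine le_trans (Finset.card_le_card (t := P.biUnion fun a => J.biUnion fun j => U a j) ?_)
      (Finset.card_biUnion_le.trans (Finset.sum_le_sum fun αβ _ => Finset.card_biUnion_le))
  intro φ hφ
  obtain ⟨a, ha, j, hj, h⟩ := h φ hφ
  simp only [mem_biUnion]
  exact ⟨a, ha, j, hj, h⟩

set_option maxHeartbeats 1000000 in
theorem padic_ineq (t : ℕ) (ht : 0 < t) (M : ℕ) [NeZero M] (p : ℕ) [Fact p.Prime] (A : Finset ℤ) (h0 : ∀ a ∈ A, a ≠ 0)
    (K : ℕ) (hK : ∀ a ∈ A, |a| ≤ K) (hM : 2 * t * K < M) (J : Finset ℕ) (hJ : ∀ a ∈ A, padicValInt p a ∈ J)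
    (b : ℕ → ℝ) (hb : ∀ j ∈ J, 0 < b j) (hBd : ∀ j ∈ J, Bd t (fS (eA M) (A.filter fun a => padicValInt p a = j)) (b j)) :
    Bd t (fS (eA M) A) (Real.sqrt ((2 * t) ^ 2 * ∑ j ∈ J, b j ^ 2)) := by
  set f := fS (eA M) A with hf
  set Q := ∑ j ∈ J, b j ^ 2 with hQ
  have hQ0 : 0 ≤ Q := Finset.sum_nonneg fun j _ => sq_nonneg _
  have hMR : (0 : ℝ) < M := by exact_mod_cast Nat.pos_of_ne_zero (NeZero.ne M)
  have hne : Nonempty (Fin t ⊕ Fin t) := ⟨Sum.inl ⟨0, ht⟩⟩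
  set E := ∑ x, ‖f x‖ ^ (2 * t) with hE
  have hE0 : 0 ≤ E := Finset.sum_nonneg fun x _ => by positivity
  set SS : (Fin t ⊕ Fin t) × (Fin t ⊕ Fin t) → ℕ → (Fin t ⊕ Fin t) → Finset ℤ := fun αβ j i =>
    if i = αβ.1 ∨ i = αβ.2 then A.filter (fun a => padicValInt p a = j) else A with hSS
  have hcount : (sol (eA M) (sgn (s := t)) fun _ => A).card ≤
      ∑ αβ ∈ (univ : Finset (Fin t ⊕ Fin t)).offDiag, ∑ j ∈ J,
        (sol (eA M) (sgn (s := t)) (SS αβ j)).card := by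
    refine card_cover _ _ J (fun αβ j => sol (eA M) (sgn (s := t)) (SS αβ j)) ?_
    intro φ hφ
    rw [mem_sol] at hφ
    obtain ⟨hA, h1⟩ := hφ
    have hsum : ∑ i, sgn i * φ i = 0 := by
      refine eA_prod_eq_one M φ sgn ?_ h1
      have hle : |∑ i, sgn i * φ i| ≤ ∑ i : Fin t ⊕ Fin t, (K : ℤ) := by
        refine (Finset.abs_sum_le_sum_abs _ _).trans (Finset.sum_le_sum fun i _ => ?_)
        rw [abs_mul]
        have : |sgn i| = 1 := by rcases i with i | i <;> simp [sgn]
        rw [this, one_mul]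
        exact hK _ (hA i)
      refine hle.trans_lt ?_
      simp only [sum_const, card_univ, Fintype.card_sum, Fintype.card_fin, nsmul_eq_mul]
      have : ((2 * t * K : ℕ) : ℤ) < M := by exact_mod_cast hM
      push_cast at *
      linarith
    obtain ⟨α, β, hab, hv⟩ := exists_pair p φ sgn (by rintro (i | i) <;> simp [sgn]) (fun i => h0 _ (hA i)) hsum
    refine ⟨(α, β), by simp [hab], ?_⟩
    refine ⟨padicValInt p (φ α), hJ _ (hA α), ?_⟩
    rw [mem_sol]
    refine ⟨fun i => ?_, h1⟩
    simp only [hSS]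
    split_ifs with hi
    · rw [mem_filter]
      refine ⟨hA i, ?_⟩
      rcases hi with rfl | rfl
      · rfl
      · exact hv.symm
    · exact hA i
  have hEeq := energy_eq t (eA M) A
  rw [← hf, ← hE] at hEeq
  rw [ZMod.card] at hEeq
  have hEle : E ≤ ∑ αβ ∈ (univ : Finset (Fin t ⊕ Fin t)).offDiag, ∑ j ∈ J, ∑ x,
      ‖fS (eA M) (A.filter fun a => padicValInt p a = j) x‖ ^ 2 * ‖f x‖ ^ (2 * t - 2) := by
    calc E ≤ M * ((∑ αβ ∈ (univ : Finset (Fin t ⊕ Fin t)).offDiag, ∑ j ∈ J,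
        (sol (eA M) (sgn (s := t)) (SS αβ j)).card : ℕ) : ℝ) := by
          rw [hEeq]
          have h9 := (Nat.cast_le (α := ℝ)).2 hcount
          exact mul_le_mul_of_nonneg_left h9 hMR.le
      _ ≤ _ := by
          push_cast
          rw [Finset.mul_sum]
          refine Finset.sum_le_sum fun αβ hαβ => ?_
          rw [Finset.mul_sum]
          refine Finset.sum_le_sum fun j _ => ?_
          have := energy_le (eA M) (SS αβ j)
          rw [ZMod.card] at this
          refine this.trans (Finset.sum_le_sum fun x _ => le_of_eq ?_)
          have h5 : ∀ i, ‖fS (eA M) (SS αβ j i) x‖ = if i ∈ ({αβ.1, αβ.2} : Finset _) then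
              ‖fS (eA M) (A.filter fun a => padicValInt p a = j) x‖ else ‖f x‖ := by
            intro i
            simp only [hSS, mem_insert, mem_singleton]
            split_ifs <;> rfl
          simp only [h5]
          rw [Finset.prod_ite, Finset.prod_const, Finset.prod_const, Finset.filter_mem_eq_inter, Finset.univ_inter,
            Finset.filter_notMem_eq_sdiff, Finset.card_sdiff_of_subset (subset_univ _)]
          rw [mem_offDiag] at hαβ
          rw [Finset.card_pair hαβ.2.2]
          congr 2
          simp; omega
  unfold Bd
  rw [ZMod.card, ← hE]
  rcases hE0.eq_or_lt with hz | hpos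
  · rw [← hz]; positivity
  set m := (E / M) ^ (1 / (2 * t : ℝ)) with hm
  have hm0 : 0 < m := by positivity
  have hmpow : m ^ (2 * t) = E / M := by
    rw [hm, ← Real.rpow_natCast, ← Real.rpow_mul (by positivity)]
    have htR : (t : ℝ) ≠ 0 := by positivity
    push_cast
    rw [one_div_mul_cancel (by positivity), Real.rpow_one]
  have hBdm : Bd t f m := by
    unfold Bd
    rw [ZMod.card, hmpow, mul_div_cancel₀ _ hMR.ne']
  have hE2 : E ≤ (2 * t) ^ 2 * (M * (Q * m ^ (2 * t - 2))) := by
    refine hEle.trans ?_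
    have h6 : ∀ αβ ∈ (univ : Finset (Fin t ⊕ Fin t)).offDiag, ∑ j ∈ J, ∑ x,
        ‖fS (eA M) (A.filter fun a => padicValInt p a = j) x‖ ^ 2 * ‖f x‖ ^ (2 * t - 2) ≤ M * (Q * m ^ (2 * t - 2)) := by
      intro αβ _
      rw [hQ, Finset.sum_mul, Finset.mul_sum]
      refine Finset.sum_le_sum fun j hj => ?_
      have := Bd.holder ht (hb j hj) hm0 (hBd j hj) hBdm 2 (2 * t - 2) (by omega)
      rwa [ZMod.card] at this
    refine (Finset.sum_le_sum h6).trans ?_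
    rw [Finset.sum_const, nsmul_eq_mul]
    refine mul_le_mul_of_nonneg_right ?_ (by positivity)
    rw [Finset.offDiag_card]
    simp only [card_univ, Fintype.card_sum, Fintype.card_fin]
    have : (t + t) * (t + t) - (t + t) ≤ (2 * t) ^ 2 := by
      have : (t + t) * (t + t) = (2 * t) ^ 2 := by ring
      omega
    exact_mod_cast this
  have hm2 : m ^ 2 ≤ (2 * t) ^ 2 * Q := by
    have h7 : E = M * (m ^ 2 * m ^ (2 * t - 2)) := by
      rw [← pow_add, show 2 + (2 * t - 2) = 2 * t by omega, hmpow, mul_div_cancel₀ _ hMR.ne']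
    rw [h7] at hE2
    have h8 : (M * m ^ (2 * t - 2)) * m ^ 2 ≤ (M * m ^ (2 * t - 2)) * ((2 * t) ^ 2 * Q) := by linarith
    exact le_of_mul_le_mul_left h8 (by positivity)
  have hmle : m ≤ Real.sqrt ((2 * t) ^ 2 * Q) := Real.le_sqrt_of_sq_le hm2
  calc E = M * m ^ (2 * t) := by rw [hmpow, mul_div_cancel₀ _ hMR.ne']
    _ ≤ _ := by gcongr

/-- multiplicative characters, via valuations -/
noncomputable def eM {ι : Type*} [Fintype ι] (N : ℕ) [NeZero N] (pr : ι → ℕ) (a : ℤ) : AddChar (ι → ZMod N) ℂ :=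
  ZMod.stdAddChar.compAddMonoidHom (∑ i, (AddMonoidHom.mulLeft ((padicValInt (pr i) a : ℕ) : ZMod N)).comp (Pi.evalAddMonoidHom _ i))

theorem eM_apply {ι : Type*} [Fintype ι] (N : ℕ) [NeZero N] (pr : ι → ℕ) (a : ℤ) (x : ι → ZMod N) :
    eM N pr a x = ZMod.stdAddChar (∑ i, ((padicValInt (pr i) a : ℕ) : ZMod N) * x i) := by
  simp [eM]

theorem eM_shift {ι : Type*} [Fintype ι] [DecidableEq ι] (N : ℕ) [NeZero N] (pr : ι → ℕ) (a : ℤ) (x : ι → ZMod N) (i : ι) (t : ZMod N) :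
    eM N pr a (x + Pi.single i t) = ZMod.stdAddChar (t * ((padicValInt (pr i) a : ℕ) : ZMod N)) * eM N pr a x := by
  rw [AddChar.map_add_eq_mul, mul_comm, eM_apply N pr a (Pi.single i t)]
  congr 2
  rw [Finset.sum_eq_single i]
  · simp [mul_comm]
  · intro k _ hk; simp [Pi.single_eq_of_ne hk]
  · simp

theorem DD_homog (s : ℕ) (W u v : ℝ) : DD s (W * u) (W * v) = W ^ (2 * s) * DD s u v := by
  unfold DD
  rw [Finset.mul_sum]
  refine Finset.sum_congr rfl fun m hm => ?_
  have : m ≤ s := by rw [mem_range] at hm; omega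
  have h : W ^ (2 * s) = (W ^ (s - m) * W ^ m) ^ 2 := by
    rw [← pow_add, Nat.sub_add_cancel this, ← pow_mul]; ring
  rw [h]; ring

theorem tree_mult {ι : Type*} [Fintype ι] [DecidableEq ι] (s N : ℕ) [Fact N.Prime] (hG : Good s) (hsN : s < N)
    (pr : ι → ℕ) (i : ι) (A : Finset ℤ) (hA : A.Nonempty) (hv : ∀ a ∈ A, padicValInt (pr i) a < N)
    (y : ℕ → ℝ) (J : Finset ℕ) (hJ : J = A.image fun a => padicValInt (pr i) a)
    (hy : ∀ j ∈ J, 0 < y j) (Y : ℝ) (hY : ∀ j ∈ J, y j ≤ Y) (hY2 : (∑ j ∈ J, y j) / 2 ≤ Y)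
    (hBd : ∀ j ∈ J, Bd s (fS (eM N pr) (A.filter fun a => padicValInt (pr i) a = j))
      (((A.filter fun a => padicValInt (pr i) a = j).card : ℝ) ^ (1 - aa s) * y j ^ aa s)) :
    Bd s (fS (eM N pr) A) ((A.card : ℝ) ^ (1 - aa s) * Y ^ aa s) := by
  have hs100 : 100 ≤ s := hG.1
  have ha0 : 0 < aa s := aa_pos (by omega)
  set a := aa s with haa
  set F : ℕ → (ι → ZMod N) → ℂ := fun j => fS (eM N pr) (A.filter fun a => padicValInt (pr i) a = j) with hF
  set n : ℕ → ℝ := fun j => ((A.filter fun a => padicValInt (pr i) a = j).card : ℝ) with hn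
  have hJne : J.Nonempty := by rw [hJ]; exact hA.image _
  have hn0 : ∀ j ∈ J, 0 < n j := by
    intro j hj
    rw [hJ, mem_image] at hj
    obtain ⟨z, hz, hzj⟩ := hj
    simp only [hn, Nat.cast_pos, Finset.card_pos]
    exact ⟨z, by simp [hz, hzj]⟩
  have hmaps : ∀ z ∈ A, padicValInt (pr i) z ∈ J := by
    intro z hz; rw [hJ]; exact mem_image_of_mem _ hz
  have hcard : ∑ j ∈ J, n j = A.card := by
    have := Finset.card_eq_sum_card_fiberwise (f := fun z => padicValInt (pr i) z) (s := A) (t := J) hmaps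
    rw [this]; push_cast; rfl
  have hA0 : (0 : ℝ) < A.card := by exact_mod_cast Finset.card_pos.2 hA
  have hY0 : 0 < Y := by
    obtain ⟨j, hj⟩ := hJne
    exact (hy j hj).trans_le (hY j hj)
  set W := (A.card : ℝ) ^ (1 - a) * Y ^ a with hW
  have hW0 : 0 < W := by positivity
  have hbW : ∀ j ∈ J, n j ^ (1 - a) * y j ^ a = W * ((n j / A.card) ^ (1 - a) * (y j / Y) ^ a) := by
    intro j hj
    have := hn0 j hj
    have := hy j hj
    rw [Real.div_rpow (by positivity) (by positivity), Real.div_rpow (by positivity) (by positivity), hW]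
    field_simp
  have hsumF : ∀ x, fS (eM N pr) A x = ∑ j ∈ J, F j x := by
    intro x
    exact (Finset.sum_fiberwise_of_maps_to hmaps _).symm
  have hb0 : ∀ j ∈ J, 0 < n j ^ (1 - a) * y j ^ a := fun j hj => by
    have := hn0 j hj
    have := hy j hj
    positivity
  have hshift : ∀ j ∈ J, ∀ x t, F j (x + Pi.single i t) = ZMod.stdAddChar (t * (j : ZMod N)) * F j x := by
    intro j _ x t
    simp only [hF, fS]
    rw [Finset.mul_sum]
    refine Finset.sum_congr rfl fun z hz => ?_
    rw [mem_filter] at hz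
    rw [eM_shift, hz.2]
  have havg := shift_avg (s := s) i J F hshift
  have hNR : (0 : ℝ) < N := by exact_mod_cast (Fact.out : N.Prime).pos
  have hJN : ∀ j ∈ J, j < N := by
    intro j hj
    rw [hJ, mem_image] at hj
    obtain ⟨z, hz, rfl⟩ := hj
    exact hv z hz
  have finish : ∀ D : ℝ, D ≤ W ^ (2 * s) → ∑ x, ∑ t : ZMod N, ‖∑ j ∈ J, ZMod.stdAddChar (t * (j : ZMod N)) * F j x‖ ^ (2 * s) ≤
      N * ((Fintype.card (ι → ZMod N) : ℝ) * D) → Bd s (fS (eM N pr) A) W := by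
    intro D hD h
    rw [havg] at h
    have h2 := le_of_mul_le_mul_left h hNR
    unfold Bd
    simp only [hsumF]
    exact h2.trans (by gcongr)
  have hp1 : ∑ j ∈ J, n j / A.card = 1 := by rw [← Finset.sum_div, hcard, div_self hA0.ne']
  have hq2 : ∑ j ∈ J, y j / Y ≤ 2 := by
    rw [← Finset.sum_div, div_le_iff₀ hY0]; linarith
  have hri := RI s hG J hJne (fun j => n j / A.card) (fun j => y j / Y) (fun j hj => div_pos (hn0 j hj) hA0) hp1
    (fun j hj => div_pos (hy j hj) hY0) (fun j hj => (div_le_one hY0).2 (hY j hj)) hq2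
  rcases hri with h | ⟨j0, hj0, h⟩
  · refine finish _ ?_ (caseA (by omega) J hJne hJN F (fun j => n j ^ (1 - a) * y j ^ a) hb0 hBd)
    have e2 : ∑ j ∈ J, (n j ^ (1 - a) * y j ^ a) ^ 2 = W ^ 2 * ∑ j ∈ J, ((n j / A.card) ^ (1 - a) * (y j / Y) ^ a) ^ 2 := by
      rw [Finset.mul_sum]
      exact Finset.sum_congr rfl fun j hj => by rw [hbW j hj, mul_pow]
    rw [e2, Finset.sum_congr rfl hbW, ← Finset.mul_sum, mul_pow]
    have h2 : W ^ (2 * s) = W ^ (2 * s - 2) * W ^ 2 := by rw [← pow_add]; congr 1; omega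
    rw [h2]
    have h3 : 0 < W ^ (2 * s - 2) * W ^ 2 := by positivity
    refine le_trans (le_of_eq ?_) (mul_le_of_le_one_right h3.le h)
    ring
  · rcases (J.erase j0).eq_empty_or_nonempty with he | hne
    · have hJs : J = {j0} := by
        rw [Finset.erase_eq_empty_iff] at he
        rcases he with he | he
        · exact absurd he hJne.ne_empty
        · exact he
      have hAA : (A.filter fun a => padicValInt (pr i) a = j0) = A := by
        refine Finset.filter_true_of_mem fun z hz => ?_
        have := hmaps z hz
        rw [hJs, mem_singleton] at this
        exact this
      have hb := hBd j0 hj0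
      rw [hAA] at hb
      have := hy j0 hj0
      refine hb.mono (by positivity) ?_
      rw [hW]
      have := hY j0 hj0
      gcongr
    · refine finish _ ?_ (caseB (by omega) hsN J hJN j0 hj0 hne F (fun j => n j ^ (1 - a) * y j ^ a) hb0 hBd)
      rw [hbW j0 hj0, Finset.sum_congr rfl fun j hj => hbW j (Finset.mem_of_mem_erase hj), ← Finset.mul_sum, DD_homog]
      exact mul_le_of_le_one_right (by positivity) (h hne)

theorem norm_eA {M : ℕ} [NeZero M] (a : ℤ) (x : ZMod M) : ‖eA M a x‖ = 1 := AddChar.norm_apply _ _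

theorem norm_fS_le {X : Type*} [AddCommGroup X] [Finite X] (e : ℤ → AddChar X ℂ) (A : Finset ℤ) (x : X) : ‖fS e A x‖ ≤ A.card := by
  unfold fS
  refine (norm_sum_le _ _).trans ?_
  simp [AddChar.norm_apply]

theorem tree {ι : Type*} [Fintype ι] [DecidableEq ι] (s N : ℕ) [Fact N.Prime] (hG : Good s) (hsN : s < N)
    (pr : ι → ℕ) (hpr : ∀ i, (pr i).Prime) (t : ℕ) (ht : 0 < t) (M K : ℕ) [NeZero M] (hM : 2 * t * K < M) (L : Finset ι) :
    ∀ A : Finset ℤ, A.Nonempty → (∀ a ∈ A, a ≠ 0) → (∀ a ∈ A, |a| ≤ K) → (∀ a ∈ A, ∀ i, padicValInt (pr i) a < N) →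
      (∀ a ∈ A, ∀ b ∈ A, (∀ i ∈ L, padicValInt (pr i) a = padicValInt (pr i) b) → |a| = |b|) →
      ∃ y : ℝ, 0 < y ∧ y ≤ A.card ∧ Bd s (fS (eM N pr) A) ((A.card : ℝ) ^ (1 - aa s) * y ^ aa s) ∧
        ∀ q : ℕ, ∃ A' ⊆ A, Bd t (fS (eA M) A') ((2 * t) ^ q * Real.sqrt (2 * A'.card)) ∧ y ≤ A'.card + A.card / 2 ^ q := by
  classical
  induction L using Finset.induction_on with
  | empty =>
    intro A hA h0 hK hv hH
    have hA0 : (0 : ℝ) < A.card := by exact_mod_cast Finset.card_pos.2 hA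
    refine ⟨A.card, hA0, le_rfl, ?_, ?_⟩
    · rw [← Real.rpow_add hA0, sub_add_cancel, Real.rpow_one]
      exact Bd.of_le fun x => norm_fS_le _ _ x
    · intro q
      refine ⟨A, Finset.Subset.refl _, ?_, ?_⟩
      · obtain ⟨z, hz⟩ := hA
        have hcard : A.card ≤ 2 := by
          refine (Finset.card_le_card (t := {z, -z}) ?_).trans Finset.card_le_two
          intro b hb
          have := hH b hb z hz (by simp)
          rw [mem_insert, mem_singleton]
          exact abs_eq_abs.1 this
        have hc2 : (A.card : ℝ) ≤ 2 := by exact_mod_cast hcard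
        have h1 : (A.card : ℝ) ≤ Real.sqrt (2 * A.card) := Real.le_sqrt_of_sq_le (by nlinarith)
        refine Bd.of_le fun x => (norm_fS_le _ _ x).trans (h1.trans ?_)
        refine le_mul_of_one_le_left (Real.sqrt_nonneg _) (one_le_pow₀ ?_)
        have : (1 : ℝ) ≤ t := by exact_mod_cast ht
        linarith
      · have : (0 : ℝ) ≤ A.card / 2 ^ q := by positivity
        linarith
  | insert i L hi ih =>
    intro A hA h0 hK hv hH
    have : Fact (pr i).Prime := ⟨hpr i⟩
    set J := A.image fun a => padicValInt (pr i) a with hJ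
    have hJne : J.Nonempty := hA.image _
    have hmaps : ∀ z ∈ A, padicValInt (pr i) z ∈ J := fun z hz => mem_image_of_mem _ hz
    set Af : ℕ → Finset ℤ := fun j => A.filter fun a => padicValInt (pr i) a = j with hAf
    have hsub : ∀ j, Af j ⊆ A := fun j => Finset.filter_subset _ _
    have hex : ∀ j ∈ J, ∃ y : ℝ, 0 < y ∧ y ≤ (Af j).card ∧ Bd s (fS (eM N pr) (Af j)) (((Af j).card : ℝ) ^ (1 - aa s) * y ^ aa s) ∧
        ∀ q : ℕ, ∃ A' ⊆ Af j, Bd t (fS (eA M) A') ((2 * t) ^ q * Real.sqrt (2 * A'.card)) ∧ y ≤ A'.card + (Af j).card / 2 ^ q := by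
      intro j hj
      refine ih (Af j) ?_ (fun a ha => h0 a (hsub j ha)) (fun a ha => hK a (hsub j ha)) (fun a ha => hv a (hsub j ha)) ?_
      · rw [hJ, mem_image] at hj
        obtain ⟨z, hz, hzj⟩ := hj
        exact ⟨z, by simp [hAf, hz, hzj]⟩
      · intro a ha b hb hab
        refine hH a (hsub j ha) b (hsub j hb) ?_
        intro k hk
        rw [mem_insert] at hk
        rcases hk with rfl | hk
        · simp only [hAf, mem_filter] at ha hb
          rw [ha.2, hb.2]
        · exact hab k hk
    choose! y hy0 hyle hyBd hyE using hex
    have hcard : ∑ j ∈ J, ((Af j).card : ℝ) = A.card := by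
      have := Finset.card_eq_sum_card_fiberwise (f := fun z => padicValInt (pr i) z) (s := A) (t := J) hmaps
      rw [this]; push_cast; rfl
    obtain ⟨jm, hjm, hmax⟩ := Finset.exists_max_image J y hJne
    have hA0 : (0 : ℝ) < A.card := by exact_mod_cast Finset.card_pos.2 hA
    have hsumy : ∑ j ∈ J, y j ≤ A.card := by
      rw [← hcard]; exact Finset.sum_le_sum hyle
    have hjmA : ((Af jm).card : ℝ) ≤ A.card := by exact_mod_cast Finset.card_le_card (hsub jm)
    refine ⟨max (y jm) ((∑ j ∈ J, y j) / 2), lt_max_of_lt_left (hy0 jm hjm), ?_, ?_, ?_⟩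
    · refine max_le ((hyle jm hjm).trans hjmA) (by linarith)
    · exact tree_mult s N hG hsN pr i A hA (fun a ha => hv a ha i) y J hJ hy0 _ (fun j hj => le_max_of_le_left (hmax j hj))
        (le_max_right _ _) hyBd
    · intro q
      rcases le_total ((∑ j ∈ J, y j) / 2) (y jm) with hc | hc
      · rw [max_eq_left hc]
        obtain ⟨A', hs', hB', hy'⟩ := hyE jm hjm q
        refine ⟨A', hs'.trans (hsub jm), hB', hy'.trans ?_⟩
        gcongr
      · rw [max_eq_right hc]
        rcases q with _ | q
        · refine ⟨∅, by simp, ?_, ?_⟩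
          · refine Bd.of_le fun x => ?_
            simp [fS]
          · simp; linarith
        · have hEq := fun j hj => hyE j hj q
          choose! A' hs' hB' hy' using hEq
          set U := J.biUnion A' with hU
          have hUA : U ⊆ A := by
            rw [hU, Finset.biUnion_subset]
            exact fun j hj => (hs' j hj).trans (hsub j)
          have hfib : ∀ j ∈ J, (U.filter fun a => padicValInt (pr i) a = j) = A' j := by
            intro j hj
            ext z
            simp only [hU, mem_filter, mem_biUnion]
            constructor
            · rintro ⟨⟨k, hk, hzk⟩, hzj⟩
              have := hs' k hk hzk
              simp only [hAf, mem_filter] at this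
              have hkj : k = j := this.2.symm.trans hzj
              rwa [← hkj]
            · intro hz
              have := hs' j hj hz
              simp only [hAf, mem_filter] at this
              exact ⟨⟨j, hj, hz⟩, this.2⟩
          have hUJ : ∀ z ∈ U, padicValInt (pr i) z ∈ J := fun z hz => hmaps z (hUA hz)
          have hUcard : ∑ j ∈ J, ((A' j).card : ℝ) = U.card := by
            have := Finset.card_eq_sum_card_fiberwise (f := fun z => padicValInt (pr i) z) (s := U) (t := J) hUJ
            rw [this]; push_cast
            exact Finset.sum_congr rfl fun j hj => by rw [hfib j hj]
          refine ⟨U, hUA, ?_, ?_⟩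
          · set J' := J.filter fun j => (A' j).Nonempty with hJ'
            have hpi := padic_ineq t ht M (pr i) U (fun a ha => h0 a (hUA ha)) K (fun a ha => hK a (hUA ha)) hM J' (by
              intro z hz
              rw [hJ', mem_filter]
              refine ⟨hUJ z hz, ?_⟩
              rw [← hfib _ (hUJ z hz)]
              exact ⟨z, by simp [hz]⟩)
              (fun j => (2 * t) ^ q * Real.sqrt (2 * (A' j).card)) (by
                intro j hj
                rw [hJ', mem_filter] at hj
                have : (0 : ℝ) < (A' j).card := by exact_mod_cast Finset.card_pos.2 hj.2
                positivity) (by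
                intro j hj
                rw [hJ', mem_filter] at hj
                rw [hfib j hj.1]
                exact hB' j hj.1)
            have hsumJ' : ∑ j ∈ J', ((A' j).card : ℝ) ≤ U.card := by
              rw [← hUcard]
              exact Finset.sum_le_sum_of_subset_of_nonneg (Finset.filter_subset _ _) fun _ _ _ => by positivity
            refine hpi.mono (Real.sqrt_nonneg _) ?_
            rw [Real.sqrt_le_left (by positivity)]
            have e1 : ∀ j, ((2 * (t : ℝ)) ^ q * Real.sqrt (2 * (A' j).card)) ^ 2 = ((2 * (t : ℝ)) ^ q) ^ 2 * 2 * (A' j).card := by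
              intro j
              rw [mul_pow, Real.sq_sqrt (by positivity)]; ring
            simp only [e1]
            rw [← Finset.mul_sum, mul_pow ((2 * (t : ℝ)) ^ (q + 1)), Real.sq_sqrt (by positivity)]
            calc (2 * (t : ℝ)) ^ 2 * (((2 * (t : ℝ)) ^ q) ^ 2 * 2 * ∑ j ∈ J', ((A' j).card : ℝ)) ≤
                (2 * (t : ℝ)) ^ 2 * (((2 * (t : ℝ)) ^ q) ^ 2 * 2 * U.card) := by gcongr
              _ = _ := by ring
          · have h1 := Finset.sum_le_sum hy'
            rw [Finset.sum_add_distrib, hUcard, ← Finset.sum_div, hcard] at h1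
            have h2 : (A.card : ℝ) / 2 ^ q = 2 * (A.card / 2 ^ (q + 1)) := by rw [pow_succ]; field_simp
            rw [h2] at h1
            have h3 : (0 : ℝ) ≤ U.card := by positivity
            linarith

theorem padicValInt_prod (p : ℕ) [Fact p.Prime] {I : Type*} (S : Finset I) (f : I → ℤ) (hf : ∀ i ∈ S, f i ≠ 0) :
    padicValInt p (∏ i ∈ S, f i) = ∑ i ∈ S, padicValInt p (f i) := by
  classical
  induction S using Finset.induction_on with
  | empty => simp
  | insert a S ha ih =>
    rw [Finset.prod_insert ha, Finset.sum_insert ha, padicValInt.mul (hf a (mem_insert_self _ _)),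
      ih fun i hi => hf i (mem_insert_of_mem hi)]
    exact Finset.prod_ne_zero_iff.2 fun i hi => hf i (mem_insert_of_mem hi)

theorem eM_prod {ι : Type*} [Fintype ι] (N : ℕ) [NeZero N] (pr : ι → ℕ) (hpr : ∀ i, (pr i).Prime) (s : ℕ) (f : Fin s → ℤ)
    (hf : ∀ i, f i ≠ 0) (x : ι → ZMod N) :
    (∏ i, eM N pr (f i)) x = ZMod.stdAddChar (∑ k, ((padicValInt (pr k) (∏ i, f i) : ℕ) : ZMod N) * x k) := by
  rw [AddChar.prod_apply]
  simp only [eM_apply]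
  rw [← char_map_sum, Finset.sum_comm]
  congr 1
  refine Finset.sum_congr rfl fun k _ => ?_
  have : Fact (pr k).Prime := ⟨hpr k⟩
  rw [padicValInt_prod (pr k) univ f fun i _ => hf i, ← Finset.sum_mul]
  push_cast; rfl

theorem piece (s : ℕ) (hG : Good s) (t : ℕ) (ht : 0 < t) (M K : ℕ) [NeZero M] (hM : 2 * t * K < M)
    (C : Finset ℤ) (hC : C.Nonempty) (h0 : ∀ a ∈ C, a ≠ 0) (hK : ∀ a ∈ C, |a| ≤ K) :
    ∃ y : ℝ, 0 < y ∧ y ≤ C.card ∧ (TkMul s C : ℝ) ≤ ((C.card : ℝ) ^ (1 - aa s) * y ^ aa s) ^ (2 * s) ∧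
        ∀ q : ℕ, ∃ A' ⊆ C, Bd t (fS (eA M) A') ((2 * t) ^ q * Real.sqrt (2 * A'.card)) ∧ y ≤ A'.card + C.card / 2 ^ q := by
  classical
  obtain ⟨N, hN, hNp⟩ := Nat.exists_infinite_primes (s + K + 1)
  have : Fact N.Prime := ⟨hNp⟩
  set PR := (range (K + 1)).filter Nat.Prime with hPR
  set pr : PR → ℕ := fun i => i.1 with hprdef
  have hpr : ∀ i, (pr i).Prime := fun i => (mem_filter.1 i.2).2
  have hpow : ∀ a ∈ C, ∀ p : ℕ, p.Prime → p ^ padicValInt p a ≤ K := by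
    intro a ha p hp
    have hd : p ^ padicValInt p a ∣ a.natAbs := pow_padicValNat_dvd
    have h1 := Nat.le_of_dvd (Int.natAbs_pos.2 (h0 a ha)) hd
    have h2 := hK a ha
    rw [Int.abs_eq_natAbs] at h2
    have h3 : a.natAbs ≤ K := by exact_mod_cast h2
    omega
  obtain ⟨y, hy0, hy1, hyB, hyE⟩ := tree s N hG (by omega) pr hpr t ht M K hM univ C hC h0 hK (by
      intro a ha i
      have h1 := hpow a ha (pr i) (hpr i)
      have h2 := Nat.lt_pow_self (hpr i).one_lt (n := padicValInt (pr i) a)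
      omega) (by
      intro a ha b hb hab
      rw [Int.abs_eq_natAbs, Int.abs_eq_natAbs]
      congr 1
      rw [Nat.eq_iff_prime_padicValNat_eq _ _ (Int.natAbs_ne_zero.2 (h0 a ha)) (Int.natAbs_ne_zero.2 (h0 b hb))]
      intro p hp
      by_cases hpK : p ≤ K
      · have hmem : p ∈ PR := by rw [hPR, mem_filter, mem_range]; exact ⟨by omega, hp⟩
        exact hab ⟨p, hmem⟩ (mem_univ _)
      · have hz : ∀ c ∈ C, padicValNat p c.natAbs = 0 := by
          intro c hc
          by_contra hne
          have h1 := hpow c hc p hp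
          have h2 : p ^ 1 ≤ p ^ padicValInt p c := Nat.pow_le_pow_right hp.pos (Nat.one_le_iff_ne_zero.2 hne)
          rw [pow_one] at h2
          omega
        rw [hz a ha, hz b hb])
  refine ⟨y, hy0, hy1, ?_, hyE⟩
  have hcl := count_le s (eM N pr) C (fun f => (∀ i, f.1 i ∈ C) ∧ (∀ i, f.2 i ∈ C) ∧ ∏ i, f.1 i = ∏ i, f.2 i) (by
    rintro f ⟨h1, h2, h3⟩
    refine ⟨h1, h2, ?_⟩
    ext x
    rw [eM_prod N pr hpr s f.1 (fun i => h0 _ (h1 i)), eM_prod N pr hpr s f.2 (fun i => h0 _ (h2 i)), h3])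
  have hX : (0 : ℝ) < Fintype.card (PR → ZMod N) := by exact_mod_cast Fintype.card_pos
  exact le_of_mul_le_mul_left (hcl.trans hyB) hX

theorem TkAdd_le (s : ℕ) (M : ℕ) [NeZero M] (B : Finset ℤ) :
    (M : ℝ) * TkAdd s B ≤ ∑ x, ‖fS (eA M) B x‖ ^ (2 * s) := by
  have hcl := count_le s (eA M) B (fun f => (∀ i, f.1 i ∈ B) ∧ (∀ i, f.2 i ∈ B) ∧ ∑ i, f.1 i = ∑ i, f.2 i) (by
    rintro f ⟨h1, h2, h3⟩
    refine ⟨h1, h2, ?_⟩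
    ext x
    have e1 := eA_prod M f.1 (fun _ => 1) x
    have e2 := eA_prod M f.2 (fun _ => 1) x
    simp only [zpow_one, one_mul] at e1 e2
    rw [e1, e2, h3])
  rwa [ZMod.card] at hcl

theorem num_large (s : ℕ) (hs : 10 ^ 64 ≤ s) (n : ℝ) (hn0 : 0 < n) (hn : (s : ℝ) ≤ Real.logb 2 n)
    (τ : ℝ) (hτ : τ = 1 / 2000 * Real.sqrt (Real.logb 2 s / Real.logb 2 (Real.logb 2 s))) :
    ∃ (η : ℝ) (q t : ℕ), 0 ≤ η ∧ 0 < t ∧ t ≤ s ∧ 4 * τ ≤ t ∧ 2 * s * aa s * η = τ ∧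
      n / 2 ^ q ≤ n ^ (1 - η) / 2 ∧
      (2 * (t : ℝ)) ^ q * Real.sqrt 2 * n ^ (1 / 4 : ℝ) ≤ Real.sqrt (n ^ (1 - η) / 2) := by
  have hsR : (10 : ℝ) ^ 64 ≤ s := by exact_mod_cast hs
  have hs0 : (0 : ℝ) < s := lt_of_lt_of_le (by norm_num) hsR
  set l := Real.logb 2 s with hl
  set ll := Real.logb 2 l with hll
  have hl1 : 212 ≤ l := by
    rw [hl, Real.le_logb_iff_rpow_le (by norm_num) hs0]
    refine le_trans ?_ hsR
    rw [show (212 : ℝ) = (212 : ℕ) by norm_num, Real.rpow_natCast]; norm_num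
  have hll1 : 7 ≤ ll := by
    rw [hll, Real.le_logb_iff_rpow_le (by norm_num) (by linarith)]
    refine le_trans ?_ hl1
    rw [show (7 : ℝ) = (7 : ℕ) by norm_num, Real.rpow_natCast]; norm_num
  have h2l : (2 : ℝ) ^ l = s := Real.rpow_logb (by norm_num) (by norm_num) hs0
  have h2ll : (2 : ℝ) ^ ll = l := Real.rpow_logb (by norm_num) (by norm_num) (by linarith)
  have hexp : ∀ x : ℝ, 0 ≤ x → x / 2 ≤ 2 ^ x := by
    intro x hx
    have h := Real.add_one_le_exp (Real.log 2 * x)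
    rw [Real.rpow_def_of_pos (by norm_num)]
    have := Real.log_two_gt_d9
    nlinarith
  have hlll : ll ≤ l := by
    have h1 := hexp (l / 2) (by linarith)
    have h2 : (2 : ℝ) ^ ll = l := h2ll
    by_contra hc
    push Not at hc
    have h3 : (2 : ℝ) ^ l ≤ 2 ^ ll := by gcongr; norm_num
    have h4 : (2 : ℝ) ^ l = (2 ^ (l / 2)) * (2 ^ (l / 2)) := by
      rw [← Real.rpow_add (by norm_num)]; ring_nf
    nlinarith
  have hsl : 2000 * l ≤ s := by
    have h1 := hexp (l / 4) (by linarith)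
    have h4 : (2 : ℝ) ^ l = (2 ^ (l / 4)) ^ 4 := by
      rw [← Real.rpow_natCast, ← Real.rpow_mul (by norm_num)]; norm_num
    rw [← h2l, h4]
    calc 2000 * l ≤ (l / 4 / 2) ^ 4 := by
          have : (l / 4 / 2) ^ 4 = l ^ 3 / 4096 * l := by ring
          rw [this]
          have h3 : (212 : ℝ) ^ 3 ≤ l ^ 3 := by gcongr
          nlinarith
      _ ≤ _ := by gcongr
  set r := Real.sqrt (l / ll) with hr
  have hr0 : 0 < r := Real.sqrt_pos.2 (by apply div_pos <;> linarith)
  have hr2 : r ^ 2 * ll = l := by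
    rw [hr, Real.sq_sqrt (by apply div_nonneg <;> linarith)]; field_simp
  have hr1 : 1 ≤ r := by
    rw [hr, Real.one_le_sqrt, le_div_iff₀ (by linarith)]; linarith
  have hrl : r * ll ≤ l := by nlinarith
  have hrl' : r ≤ l := by nlinarith
  set L := Real.logb 2 n with hL
  have h2L : (2 : ℝ) ^ L = n := Real.rpow_logb (by norm_num) (by norm_num) hn0
  have hL0 : 0 < L := by linarith
  set η := 32 * τ / l with hη
  have hη0 : 0 ≤ η := by rw [hη, hτ]; positivity
  have hηl : η * l = 32 * τ := by rw [hη]; field_simp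
  have hηll : η * ll ≤ 32 / 2000 := by
    have : η * ll = 32 / 2000 * (r * ll / l) := by rw [hη, hτ]; field_simp
    rw [this]
    have : r * ll / l ≤ 1 := by rw [div_le_one (by linarith)]; exact hrl
    linarith
  have hη1 : η ≤ 32 / 2000 / 7 := by nlinarith
  set t := Nat.log 2 s with ht
  have hsne : s ≠ 0 := by omega
  have ht1 : (t : ℝ) ≤ l := by
    rw [hl, Real.le_logb_iff_rpow_le (by norm_num) hs0, Real.rpow_natCast]
    exact_mod_cast Nat.pow_log_le_self 2 hsne
  have ht2 : l < t + 1 := by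
    rw [hl, Real.logb_lt_iff_lt_rpow (by norm_num) hs0]
    have := Nat.lt_pow_succ_log_self (b := 2) (by norm_num) s
    have h3 : (s : ℝ) < 2 ^ (t + 1) := by exact_mod_cast this
    rw [← Real.rpow_natCast] at h3
    exact_mod_cast h3
  set q := ⌈η * L⌉₊ + 1 with hq
  have hq1 : η * L + 1 ≤ q := by
    rw [hq]; push_cast; have := Nat.le_ceil (η * L); linarith
  have hq2 : (q : ℝ) ≤ η * L + 2 := by
    rw [hq]; push_cast; have := Nat.ceil_lt_add_one (a := η * L) (by positivity); linarith
  have hnη : n ^ (1 - η) / 2 = 2 ^ (L * (1 - η) - 1) := by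
    rw [← h2L, ← Real.rpow_mul (by norm_num), Real.rpow_sub (by norm_num), Real.rpow_one]
  refine ⟨η, q, t, hη0, ?_, Nat.log_le_self _ _, ?_, ?_, ?_, ?_⟩
  · have : (0 : ℝ) < t := by linarith
    exact_mod_cast this
  · rw [hτ]; linarith
  · rw [aa, ← hl]
    have : 2 * (s : ℝ) * (l / (64 * s)) * η = η * l / 32 := by field_simp; ring
    rw [this, hηl]; ring
  · rw [hnη, ← Real.rpow_natCast 2 q]
    conv_lhs => rw [← h2L]
    rw [← Real.rpow_sub (by norm_num)]
    apply Real.rpow_le_rpow_of_exponent_le (by norm_num)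
    linarith
  · apply Real.le_sqrt_of_sq_le
    rw [mul_pow, mul_pow, Real.sq_sqrt (by norm_num), hnη]
    have h2t : 2 * (t : ℝ) ≤ 2 ^ (2 * ll) := by
      calc 2 * (t : ℝ) ≤ l * l := by nlinarith
        _ = 2 ^ (2 * ll) := by rw [two_mul, Real.rpow_add (by norm_num), h2ll]
    have e1 : (2 * (t : ℝ)) ^ q ≤ 2 ^ (2 * ll * q) := by
      rw [Real.rpow_mul (by norm_num), Real.rpow_natCast]; gcongr
    have e2 : n ^ (1 / 4 : ℝ) = 2 ^ (L / 4) := by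
      rw [← h2L, ← Real.rpow_mul (by norm_num)]; ring_nf
    rw [e2]
    calc ((2 * (t : ℝ)) ^ q) ^ 2 * 2 * (2 ^ (L / 4)) ^ 2 ≤ ((2 : ℝ) ^ (2 * ll * q)) ^ 2 * 2 * (2 ^ (L / 4)) ^ 2 := by
          gcongr
      _ = 2 ^ (4 * ll * q + 1 + L / 2) := by
          rw [← Real.rpow_natCast, ← Real.rpow_natCast, ← Real.rpow_mul (by norm_num), ← Real.rpow_mul (by norm_num),
            Real.rpow_add (by norm_num), Real.rpow_add (by norm_num), Real.rpow_one]
          push_cast; ring_nf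
      _ ≤ _ := by
          apply Real.rpow_le_rpow_of_exponent_le (by norm_num)
          have a1 : ll * q ≤ ll * (η * L + 2) := by gcongr
          have a2 : η * ll * L ≤ 32 / 2000 * L := by gcongr
          have a3 : η * L ≤ 32 / 2000 / 7 * L := by gcongr
          nlinarith

theorem TkMul_empty (s : ℕ) (hs : 0 < s) : TkMul s ∅ = 0 := by
  unfold TkMul
  rw [Set.ncard_eq_zero (Set.Finite.subset Set.finite_empty ?_), Set.eq_empty_iff_forall_notMem] <;>
  · rintro f ⟨h1, -⟩
    exact absurd (h1 ⟨0, hs⟩) (notMem_empty _)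

theorem piece2 (s : ℕ) (hG : Good s) (t q : ℕ) (ht : 0 < t) (M K : ℕ) [NeZero M] (hM : 2 * t * K < M)
    (n η τ : ℝ) (hn : 1 ≤ n) (hτ : 2 * s * aa s * η = τ)
    (hq : n / 2 ^ q ≤ n ^ (1 - η) / 2)
    (hq' : (2 * (t : ℝ)) ^ q * Real.sqrt 2 * n ^ (1 / 4 : ℝ) ≤ Real.sqrt (n ^ (1 - η) / 2))
    (C : Finset ℤ) (hCn : (C.card : ℝ) ≤ n) (h0 : ∀ a ∈ C, a ≠ 0) (hK : ∀ a ∈ C, |a| ≤ K)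
    (hT : n ^ (2 * (s : ℝ) - τ) < TkMul s C) :
    ∃ A' ⊆ C, A'.Nonempty ∧ Bd t (fS (eA M) A') (n ^ (-(1 / 4) : ℝ) * A'.card) := by
  have hn0 : 0 < n := by linarith
  have hs0 : 0 < s := by have := hG.1; omega
  have hsR : (0 : ℝ) < s := by exact_mod_cast hs0
  have ha0 : 0 < aa s := aa_pos (by have := hG.1; omega)
  have ha1 : aa s ≤ 1 / 4 := hG.2.1
  have hC : C.Nonempty := by
    rw [nonempty_iff_ne_empty]
    rintro rfl
    rw [TkMul_empty s hs0] at hT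
    have : 0 < n ^ (2 * (s : ℝ) - τ) := by positivity
    simp at hT
    linarith
  obtain ⟨y, hy0, hy1, hyT, hyE⟩ := piece s hG t ht M K hM C hC h0 hK
  have hy : n ^ (1 - η) < y := by
    by_contra hc
    push Not at hc
    have : (TkMul s C : ℝ) ≤ n ^ (2 * (s : ℝ) - τ) := by
      refine hyT.trans ?_
      calc ((C.card : ℝ) ^ (1 - aa s) * y ^ aa s) ^ (2 * s)
          ≤ (n ^ (1 - aa s) * (n ^ (1 - η)) ^ aa s) ^ (2 * s) := by
            have : 0 ≤ 1 - aa s := by linarith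
            gcongr
        _ = n ^ (2 * (s : ℝ) - τ) := by
            rw [← Real.rpow_mul hn0.le, ← Real.rpow_add hn0, ← Real.rpow_natCast, ← Real.rpow_mul hn0.le, ← hτ]
            congr 1
            push_cast; ring
    linarith
  obtain ⟨A', hA', hB, hyA⟩ := hyE q
  have hA : n ^ (1 - η) / 2 ≤ A'.card := by
    have : (C.card : ℝ) / 2 ^ q ≤ n / 2 ^ q := by gcongr
    linarith
  have hApos : (0 : ℝ) < A'.card := lt_of_lt_of_le (by positivity) hA
  refine ⟨A', hA', card_pos.1 (by exact_mod_cast hApos), Bd.mono (by positivity) ?_ hB⟩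
  have h1 : (2 * (t : ℝ)) ^ q * Real.sqrt 2 * n ^ (1 / 4 : ℝ) ≤ Real.sqrt A'.card :=
    hq'.trans (Real.sqrt_le_sqrt hA)
  have h2 : n ^ (-(1 / 4) : ℝ) * n ^ (1 / 4 : ℝ) = 1 := by rw [← Real.rpow_add hn0]; norm_num
  have h3 : (2 * (t : ℝ)) ^ q * Real.sqrt 2 ≤ n ^ (-(1 / 4) : ℝ) * Real.sqrt A'.card := by
    calc (2 * (t : ℝ)) ^ q * Real.sqrt 2 = n ^ (-(1 / 4) : ℝ) * ((2 * (t : ℝ)) ^ q * Real.sqrt 2 * n ^ (1 / 4 : ℝ)) := by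
          linear_combination (-(2 * (t : ℝ)) ^ q * Real.sqrt 2) * h2
      _ ≤ _ := by gcongr
  rw [Real.sqrt_mul (by norm_num), ← mul_assoc]
  calc _ ≤ n ^ (-(1 / 4) : ℝ) * Real.sqrt A'.card * Real.sqrt A'.card := by gcongr
    _ = _ := by rw [mul_assoc, Real.mul_self_sqrt hApos.le]

theorem Bd.add {X : Type*} [Fintype X] {s : ℕ} {f g : X → ℂ} {b c : ℝ} (hb : 0 < b) (hc : 0 < c)
    (hf : Bd s f b) (hg : Bd s g c) : Bd s (fun x => f x + g x) (b + c) := by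
  have := Bd.sum (s := s) (univ : Finset Bool) ⟨true, mem_univ _⟩ (f := fun i => if i then f else g)
    (b := fun i => if i then b else c) (by intro j _; cases j <;> simpa) (by intro j _; cases j <;> simpa)
  simpa using this

theorem fS_union {X : Type*} [AddCommGroup X] (e : ℤ → AddChar X ℂ) (S T : Finset ℤ) (h : Disjoint S T) :
    fS e (S ∪ T) = fun x => fS e S x + fS e T x := by
  ext x; simp [fS, sum_union h]

theorem decomp (s : ℕ) (hG : Good s) (t q : ℕ) (ht : 0 < t) (M K : ℕ) [NeZero M] (hM : 2 * t * K < M)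
    (n η τ : ℝ) (hn : 1 ≤ n) (hτ : 2 * s * aa s * η = τ)
    (hq : n / 2 ^ q ≤ n ^ (1 - η) / 2)
    (hq' : (2 * (t : ℝ)) ^ q * Real.sqrt 2 * n ^ (1 / 4 : ℝ) ≤ Real.sqrt (n ^ (1 - η) / 2)) (k : ℕ) :
    ∀ C : Finset ℤ, C.card = k → (C.card : ℝ) ≤ n → (∀ a ∈ C, a ≠ 0) → (∀ a ∈ C, |a| ≤ K) →
    ∃ B D, Disjoint B D ∧ C = B ∪ D ∧ (TkMul s D : ℝ) ≤ n ^ (2 * (s : ℝ) - τ) ∧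
      (B = ∅ ∨ Bd t (fS (eA M) B) (n ^ (-(1 / 4) : ℝ) * B.card)) := by
  induction k using Nat.strong_induction_on with
  | _ k ih =>
  intro C hk hCn h0 hK
  by_cases hT : (TkMul s C : ℝ) ≤ n ^ (2 * (s : ℝ) - τ)
  · exact ⟨∅, C, disjoint_empty_left _, (empty_union _).symm, hT, Or.inl rfl⟩
  push Not at hT
  obtain ⟨A', hA', hne, hB⟩ := piece2 s hG t q ht M K hM n η τ hn hτ hq hq' C hCn h0 hK hT
  have hc := card_sdiff_add_card_eq_card hA'
  have hpos := card_pos.2 hne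
  obtain ⟨B, D, hd, hu, hD, hBB⟩ := ih (C \ A').card (by omega) (C \ A') rfl
    (le_trans (by exact_mod_cast card_le_card sdiff_subset) hCn) (fun a ha => h0 a (sdiff_subset ha))
    (fun a ha => hK a (sdiff_subset ha))
  have hBC : B ⊆ C \ A' := by rw [hu]; exact subset_union_left
  have hDC : D ⊆ C \ A' := by rw [hu]; exact subset_union_right
  have hAB : Disjoint A' B := disjoint_of_subset_right hBC disjoint_sdiff
  have hAD : Disjoint A' D := disjoint_of_subset_right hDC disjoint_sdiff
  refine ⟨A' ∪ B, D, disjoint_union_left.2 ⟨hAD, hd⟩, ?_, hD, Or.inr ?_⟩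
  · rw [union_assoc, ← hu, union_sdiff_of_subset hA']
  · rcases hBB with rfl | hBB
    · simpa using hB
    rcases B.eq_empty_or_nonempty with rfl | hBne
    · simpa using hB
    have hn0 : 0 < n := by linarith
    have c1 : (0 : ℝ) < A'.card := by exact_mod_cast hpos
    have c2 : (0 : ℝ) < B.card := by exact_mod_cast card_pos.2 hBne
    rw [fS_union _ _ _ hAB, card_union_of_disjoint hAB]
    push_cast
    rw [mul_add]
    exact Bd.add (by positivity) (by positivity) hB hBB

theorem large_case (A : Finset ℤ) (s : ℕ) (hs : 10 ^ 64 ≤ s) (hn : (s : ℝ) ≤ Real.logb 2 A.card) :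
    ∃ B C : Finset ℤ, Disjoint B C ∧ A = B ∪ C ∧
      (TkAdd s B : ℝ) ≤ (A.card : ℝ) ^ (2 * (s : ℝ) - 1 / 2000 * Real.sqrt (Real.logb 2 s / Real.logb 2 (Real.logb 2 s))) ∧
      (TkMul s C : ℝ) ≤ (A.card : ℝ) ^ (2 * (s : ℝ) - 1 / 2000 * Real.sqrt (Real.logb 2 s / Real.logb 2 (Real.logb 2 s))) := by
  have hG := good_large s hs
  have hsR : (10 : ℝ) ^ 64 ≤ s := by exact_mod_cast hs
  set n : ℝ := (A.card : ℝ) with hnn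
  have hn0 : 0 < n := by
    rcases (Nat.cast_nonneg (α := ℝ) A.card).lt_or_eq with h | h
    · exact h
    · rw [hnn, ← h, Real.logb_zero] at hn; exfalso; have : (0 : ℝ) < s := lt_of_lt_of_le (by positivity) hsR
      linarith
  have hn16 : (2 : ℝ) ^ 16 ≤ n := by
    rw [← Real.rpow_natCast, ← Real.le_logb_iff_rpow_le (by norm_num) hn0]
    refine le_trans ?_ (hsR.trans hn)
    norm_num
  have hn1 : 1 ≤ n := le_trans (by norm_num) hn16
  obtain ⟨η, q, t, hη, ht, hts, hτt, hτ, hq, hq'⟩ := num_large s hs n hn0 hn _ rfl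
  set τ := 1 / 2000 * Real.sqrt (Real.logb 2 s / Real.logb 2 (Real.logb 2 s)) with hτd
  set K : ℕ := ∑ a ∈ A, a.natAbs with hKd
  have hK : ∀ a ∈ A, |a| ≤ (K : ℤ) := by
    intro a ha
    rw [Int.abs_eq_natAbs]
    exact_mod_cast single_le_sum (f := fun a : ℤ => a.natAbs) (fun _ _ => Nat.zero_le _) ha
  set M : ℕ := 2 * t * K + 1 with hMd
  have : NeZero M := ⟨by omega⟩
  obtain ⟨B, C, hd, hu, hC, hB⟩ := decomp s hG t q ht M K (by omega) n η τ hn1 hτ hq hq' _ (A.erase 0) rfl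
    (by rw [hnn]; exact_mod_cast card_le_card (erase_subset _ _)) (fun a ha => ne_of_mem_erase ha)
    (fun a ha => hK a (mem_of_mem_erase ha))
  have h0C : (0 : ℤ) ∉ C := fun h => (ne_of_mem_erase (hu ▸ mem_union_right B h : (0 : ℤ) ∈ A.erase 0)) rfl
  have h0B : (0 : ℤ) ∉ B := fun h => (ne_of_mem_erase (hu ▸ mem_union_left C h : (0 : ℤ) ∈ A.erase 0)) rfl
  set Z : Finset ℤ := A.filter (· = 0) with hZ
  have hZ1 : Z.card ≤ 1 := by
    rw [card_le_one]; intro a ha b hb; rw [hZ, mem_filter] at ha hb; rw [ha.2, hb.2]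
  have hBZ : Disjoint B Z := by
    rw [disjoint_left]; intro a ha hz; rw [hZ, mem_filter] at hz; exact h0B (hz.2 ▸ ha)
  refine ⟨B ∪ Z, C, ?_, ?_, ?_, hC⟩
  · rw [disjoint_union_left]
    refine ⟨hd, ?_⟩
    rw [disjoint_left]; intro a ha hz; rw [hZ, mem_filter] at ha; exact h0C (ha.2 ▸ hz)
  · ext a
    have := congrArg (a ∈ ·) hu
    simp only [mem_erase, mem_union, eq_iff_iff] at this
    simp only [mem_union, hZ, mem_filter]
    by_cases ha : a = 0
    · subst ha; tauto
    · tauto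
  · have hBZA : B ∪ Z ⊆ A := by
      apply union_subset _ (filter_subset _ _)
      exact (subset_union_left.trans hu.symm.subset).trans (erase_subset _ _)
    have hBcard : (B.card : ℝ) ≤ n := by
      rw [hnn]; exact_mod_cast card_le_card (subset_union_left.trans hBZA)
    have e34 : n ^ (-(1 / 4) : ℝ) * n = n ^ (3 / 4 : ℝ) := by
      rw [← Real.rpow_add_one hn0.ne']; norm_num
    have h1 : 1 ≤ n ^ (3 / 4 : ℝ) := Real.one_le_rpow hn1 (by norm_num)
    have hBd1 : Bd t (fS (eA M) B) (n ^ (3 / 4 : ℝ)) := by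
      rcases hB with rfl | hB
      · apply Bd.of_le
        intro x
        refine (norm_fS_le _ _ _).trans ?_
        simp; positivity
      · refine Bd.mono (by positivity) ?_ hB
        rw [← e34]; gcongr
    have hBd2 : Bd t (fS (eA M) Z) (n ^ (3 / 4 : ℝ)) := by
      apply Bd.of_le
      intro x
      refine (norm_fS_le _ _ _).trans (le_trans ?_ h1)
      exact_mod_cast hZ1
    have hBd := Bd.add (by positivity) (by positivity) hBd1 hBd2
    rw [← fS_union _ _ _ hBZ, ← two_mul] at hBd
    unfold Bd at hBd
    rw [ZMod.card] at hBd
    have hM0 : (0 : ℝ) < M := by exact_mod_cast (show 0 < M by omega)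
    have h2 : (M : ℝ) * TkAdd s (B ∪ Z) ≤ M * (n ^ (2 * (s - t)) * (2 * n ^ (3 / 4 : ℝ)) ^ (2 * t)) := by
      refine (TkAdd_le s M _).trans ?_
      calc ∑ x, ‖fS (eA M) (B ∪ Z) x‖ ^ (2 * s) ≤ ∑ x, n ^ (2 * (s - t)) * ‖fS (eA M) (B ∪ Z) x‖ ^ (2 * t) := by
            refine sum_le_sum fun x _ => ?_
            rw [show 2 * s = 2 * (s - t) + 2 * t by omega, pow_add]
            gcongr
            refine (norm_fS_le _ _ _).trans ?_
            rw [hnn]; exact_mod_cast card_le_card hBZA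
        _ = n ^ (2 * (s - t)) * ∑ x, ‖fS (eA M) (B ∪ Z) x‖ ^ (2 * t) := by rw [mul_sum]
        _ ≤ n ^ (2 * (s - t)) * (M * (2 * n ^ (3 / 4 : ℝ)) ^ (2 * t)) := by gcongr
        _ = _ := by ring
    refine (le_of_mul_le_mul_left h2 hM0).trans ?_
    have h4 : (2 : ℝ) ≤ n ^ (1 / 16 : ℝ) := by
      calc (2 : ℝ) = (2 ^ 16) ^ (1 / 16 : ℝ) := by
            rw [← Real.rpow_natCast, ← Real.rpow_mul (by norm_num)]; norm_num
        _ ≤ _ := by gcongr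
    calc n ^ (2 * (s - t)) * (2 * n ^ (3 / 4 : ℝ)) ^ (2 * t)
        ≤ n ^ (2 * (s - t)) * (n ^ (1 / 16 : ℝ) * n ^ (3 / 4 : ℝ)) ^ (2 * t) := by gcongr
      _ = n ^ (2 * (s : ℝ) - 3 / 8 * t) := by
          rw [← Real.rpow_add hn0, ← Real.rpow_natCast, ← Real.rpow_natCast, ← Real.rpow_mul hn0.le, ← Real.rpow_add hn0]
          congr 1
          push_cast [hts]; ring
      _ ≤ _ := by
          apply Real.rpow_le_rpow_of_exponent_le hn1
          linarith [(Nat.cast_nonneg t : (0 : ℝ) ≤ t)]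

theorem TkMul_trivial (s : ℕ) (C : Finset ℤ) (h0 : ∀ a ∈ C, a ≠ 0) :
    TkMul (s + 1) C ≤ C.card ^ (s + 1) * C.card ^ s := by
  classical
  unfold TkMul
  set T : Finset ((Fin (s + 1) → ℤ) × (Fin s → ℤ)) := Fintype.piFinset (fun _ => C) ×ˢ Fintype.piFinset (fun _ => C)
  have hT : (T : Set ((Fin (s + 1) → ℤ) × (Fin s → ℤ))).ncard = C.card ^ (s + 1) * C.card ^ s := by
    rw [Set.ncard_coe_finset]; simp [T, card_product]
  rw [← hT]
  refine Set.ncard_le_ncard_of_injOn (fun f => (f.1, fun i => f.2 i.castSucc)) ?_ ?_ (Finset.finite_toSet _)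
  · rintro f ⟨h1, h2, -⟩
    simp only [T, coe_product, Set.mem_prod, mem_coe, Fintype.mem_piFinset]
    exact ⟨h1, fun i => h2 _⟩
  · rintro ⟨f, g⟩ ⟨h1, h2, h3⟩ ⟨f', g'⟩ ⟨h1', h2', h3'⟩ h
    simp only [Prod.mk.injEq] at h h3 h3' h2 h2' ⊢
    obtain ⟨rfl, hg⟩ := h
    refine ⟨rfl, ?_⟩
    have hg' : ∀ i : Fin s, g i.castSucc = g' i.castSucc := fun i => congrFun hg i
    rw [h3, Fin.prod_univ_castSucc, Fin.prod_univ_castSucc] at h3'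
    have hp : ∏ i : Fin s, g i.castSucc = ∏ i : Fin s, g' i.castSucc := prod_congr rfl fun i _ => hg' i
    rw [hp] at h3'
    have hne : ∏ i : Fin s, g' i.castSucc ≠ 0 := prod_ne_zero_iff.2 fun i _ => h0 _ (h2' _)
    have hl := mul_left_cancel₀ hne h3'
    funext i
    refine Fin.lastCases hl hg' i

theorem TkAdd_zero (s : ℕ) (B : Finset ℤ) (hB : ∀ a ∈ B, a = 0) : TkAdd s B ≤ 1 := by
  unfold TkAdd
  rw [← Set.ncard_singleton (0 : (Fin s → ℤ) × (Fin s → ℤ))]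
  refine Set.ncard_le_ncard ?_ (Set.finite_singleton _)
  rintro ⟨f, g⟩ ⟨h1, h2, -⟩
  rw [Set.mem_singleton_iff]
  ext i
  · exact hB _ (h1 i)
  · exact hB _ (h2 i)

theorem small_case (A : Finset ℤ) (s : ℕ) (hs : 5 ≤ s) (hs' : s < 10 ^ 64) (hn : (1 : ℝ) ≤ A.card) :
    ∃ B C : Finset ℤ, Disjoint B C ∧ A = B ∪ C ∧
      (TkAdd s B : ℝ) ≤ (A.card : ℝ) ^ (2 * (s : ℝ) - 1 / 2000 * Real.sqrt (Real.logb 2 s / Real.logb 2 (Real.logb 2 s))) ∧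
      (TkMul s C : ℝ) ≤ (A.card : ℝ) ^ (2 * (s : ℝ) - 1 / 2000 * Real.sqrt (Real.logb 2 s / Real.logb 2 (Real.logb 2 s))) := by
  have hsR : (5 : ℝ) ≤ s := by exact_mod_cast hs
  have hl : 2 ≤ Real.logb 2 s := by
    rw [Real.le_logb_iff_rpow_le (by norm_num) (by linarith)]
    norm_num; linarith
  have hl' : Real.logb 2 s ≤ 256 := by
    rw [Real.logb_le_iff_le_rpow (by norm_num) (by linarith)]
    have h1 : (s : ℝ) ≤ 10 ^ 64 := by exact_mod_cast hs'.le
    refine h1.trans ?_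
    rw [show (256 : ℝ) = (256 : ℕ) by norm_num, Real.rpow_natCast]
    norm_num
  have hll : 1 ≤ Real.logb 2 (Real.logb 2 s) := by
    rw [Real.le_logb_iff_rpow_le (by norm_num) (by linarith)]
    norm_num; linarith
  have hsq : Real.sqrt (Real.logb 2 s / Real.logb 2 (Real.logb 2 s)) ≤ 16 := by
    rw [Real.sqrt_le_left (by norm_num), div_le_iff₀ (by linarith)]
    nlinarith
  have hexp : (2 * (s : ℝ) - 1) ≤ 2 * (s : ℝ) - 1 / 2000 * Real.sqrt (Real.logb 2 s / Real.logb 2 (Real.logb 2 s)) := by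
    linarith
  have hb := Real.rpow_le_rpow_of_exponent_le hn hexp
  refine ⟨A.filter (· = 0), A.filter (¬ · = 0), disjoint_filter_filter_not _ _ _, (filter_union_filter_not_eq _ _).symm, ?_, ?_⟩
  · refine le_trans ?_ hb
    refine le_trans ?_ (Real.one_le_rpow hn (by linarith))
    exact_mod_cast TkAdd_zero s _ (fun a ha => (mem_filter.1 ha).2)
  · refine le_trans ?_ hb
    obtain ⟨r, rfl⟩ : ∃ r, s = r + 1 := ⟨s - 1, by omega⟩
    have h1 := TkMul_trivial r (A.filter (¬ · = 0)) (fun a ha => (mem_filter.1 ha).2)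
    have h2 : ((A.filter (¬ · = 0)).card : ℝ) ≤ A.card := by exact_mod_cast card_le_card (filter_subset _ _)
    have h3 : (TkMul (r + 1) (A.filter (¬ · = 0)) : ℝ) ≤ ((A.filter (¬ · = 0)).card : ℝ) ^ (r + 1) * ((A.filter (¬ · = 0)).card : ℝ) ^ r := by
      exact_mod_cast h1
    refine h3.trans ?_
    calc _ ≤ (A.card : ℝ) ^ (r + 1) * (A.card : ℝ) ^ r := by gcongr
      _ = (A.card : ℝ) ^ (2 * r + 1) := by ring
      _ = _ := by
        rw [← Real.rpow_natCast]; congr 1; push_cast; ring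

/-- The hypothesis forces `s ≤ log |A|`. -/
theorem hyp_log (n s : ℕ) (hs : 5 ≤ s)
    (h : (s : ℝ) ≤ 1 / 4 * Real.logb 2 n / Real.sqrt (Real.logb 2 (Real.logb 2 n) * Real.logb 2 (Real.logb 2 (Real.logb 2 n)))) :
    (s : ℝ) ≤ Real.logb 2 n := by
  have hsR : (5 : ℝ) ≤ s := by exact_mod_cast hs
  set L := Real.logb 2 n with hL
  have hL0 : 0 ≤ L := by
    rw [hL]
    rcases Nat.eq_zero_or_pos n with rfl | hn
    · simp
    · exact Real.logb_nonneg (by norm_num) (by exact_mod_cast hn)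
  suffices hP : 1 / 4 ≤ Real.sqrt (Real.logb 2 L * Real.logb 2 (Real.logb 2 L)) by
    refine h.trans ?_
    rw [div_le_iff₀ (by linarith)]
    nlinarith
  have hpos : 0 < Real.logb 2 L * Real.logb 2 (Real.logb 2 L) := by
    by_contra hc
    rw [Real.sqrt_eq_zero_of_nonpos (not_lt.1 hc), div_zero] at h
    linarith
  apply Real.le_sqrt_of_sq_le
  by_cases hn : n ≤ 4
  · exfalso
    rcases Nat.lt_or_ge n 2 with h2 | h2
    · have : L = 0 := by
        rw [hL]; interval_cases n <;> simp
      rw [this] at hpos; simp at hpos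
    · have h2R : (2 : ℝ) ≤ n := by exact_mod_cast h2
      have h4R : (n : ℝ) ≤ 4 := by exact_mod_cast hn
      have b1 : 1 ≤ L := by
        rw [hL, Real.le_logb_iff_rpow_le (by norm_num) (by linarith)]; simpa
      have b2 : L ≤ 2 := by
        rw [hL, Real.logb_le_iff_le_rpow (by norm_num) (by linarith)]; norm_num; linarith
      have b3 : 0 ≤ Real.logb 2 L := Real.logb_nonneg (by norm_num) b1
      have b4 : Real.logb 2 L ≤ 1 := by
        rw [Real.logb_le_iff_le_rpow (by norm_num) (by linarith)]; simpa
      have b5 : Real.logb 2 (Real.logb 2 L) ≤ 0 := Real.logb_nonpos (by norm_num) b3 b4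
      nlinarith
  push Not at hn
  have h5 : (5 : ℝ) ≤ n := by exact_mod_cast hn
  have a1 : 23 / 10 ≤ L := by
    have : (23 : ℝ) ≤ Real.logb 2 ((n : ℝ) ^ 10) := by
      rw [Real.le_logb_iff_rpow_le (by norm_num) (by positivity)]
      calc (2 : ℝ) ^ (23 : ℝ) ≤ 5 ^ 10 := by norm_num
        _ ≤ _ := by gcongr
    rw [Real.logb_pow] at this
    push_cast at this; linarith
  have a2 : 6 / 5 ≤ Real.logb 2 L := by
    have : (6 : ℝ) ≤ Real.logb 2 (L ^ 5) := by
      rw [Real.le_logb_iff_rpow_le (by norm_num) (by positivity)]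
      calc (2 : ℝ) ^ (6 : ℝ) ≤ (23 / 10) ^ 5 := by norm_num
        _ ≤ _ := by gcongr
    rw [Real.logb_pow] at this
    push_cast at this; linarith
  have a3 : 1 / 4 ≤ Real.logb 2 (Real.logb 2 L) := by
    have : (1 : ℝ) ≤ Real.logb 2 (Real.logb 2 L ^ 4) := by
      rw [Real.le_logb_iff_rpow_le (by norm_num) (by positivity)]
      calc (2 : ℝ) ^ (1 : ℝ) ≤ (6 / 5) ^ 4 := by norm_num
        _ ≤ _ := by gcongr
    rw [Real.logb_pow] at this
    push_cast at this; linarith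
  nlinarith

theorem stmt19 :
    ∃ c cs : ℝ, 0 < c ∧ 0 < cs ∧
      ∀ (A : Finset ℤ) (s : ℕ), 5 ≤ s →
        (s : ℝ) ≤ c * Real.logb 2 A.card /
            Real.sqrt (Real.logb 2 (Real.logb 2 A.card) *
              Real.logb 2 (Real.logb 2 (Real.logb 2 A.card))) →
        ∃ B C : Finset ℤ, Disjoint B C ∧ A = B ∪ C ∧
          (max (TkAdd s B) (TkMul s C) : ℝ) ≤
            (A.card : ℝ) ^
              (2 * (s : ℝ) - cs * Real.sqrt (Real.logb 2 s / Real.logb 2 (Real.logb 2 s))) := by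
  refine ⟨1 / 4, 1 / 2000, by norm_num, by norm_num, ?_⟩
  intro A s hs h
  have hl := hyp_log A.card s hs h
  have hn : (1 : ℝ) ≤ A.card := by
    rcases Nat.eq_zero_or_pos A.card with h0 | h0
    · rw [h0] at hl
      have hsR : (5 : ℝ) ≤ s := by exact_mod_cast hs
      simp at hl
      omega
    · exact_mod_cast h0
  have key : ∃ B C : Finset ℤ, Disjoint B C ∧ A = B ∪ C ∧
      (TkAdd s B : ℝ) ≤ (A.card : ℝ) ^ (2 * (s : ℝ) - 1 / 2000 * Real.sqrt (Real.logb 2 s / Real.logb 2 (Real.logb 2 s))) ∧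
      (TkMul s C : ℝ) ≤ (A.card : ℝ) ^ (2 * (s : ℝ) - 1 / 2000 * Real.sqrt (Real.logb 2 s / Real.logb 2 (Real.logb 2 s))) := by
    rcases Nat.lt_or_ge s (10 ^ 64) with h1 | h1
    · exact small_case A s hs h1 hn
    · exact large_case A s h1 hl
  obtain ⟨B, C, h1, h2, h3, h4⟩ := key
  exact ⟨B, C, h1, h2, max_le h3 h4⟩
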